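/- Let d > 2, (d+2)/d < γ < 2, q = d(γ−1)/γ, p = d(γ−1)/(2−γ), λ > 0, C_H > 0, and let Ω ⊆ ℝ^d be a bounded open set. Let H : Ω × ℝ^d → ℝ satisfy the growth condition (H) with constants C_H, γ and be convex and differentiable in the gradient variable, and let f ∈ L^q(Ω). Then there exists a constant C, depending on d, γ, C_H, |Ω|, λ and on f, such that for every k > 0, every classical solution u of the Dirichlet problem −Δu + λu + H(x, Du) = f in Ω, u = 0 on ∂Ω, and every classical solution u_k of the truncated Dirichlet problem −Δu_k + λu_k + H(x, Du_k) = T_k(f) in Ω, u_k = 0 on ∂Ω, one has ‖u − u_k‖_{L^p(Ω)} ≤ C‖f − T_k(f)‖_{L^q(Ω)}. (Note that p = dq/(d−2q) for this value of q.) -/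

import Mathlib

open MeasureTheory

noncomputable section

/-- `ℝ^d` as a Euclidean space. -/
abbrev Euc (d : ℕ) := EuclideanSpace ℝ (Fin d)

/-- The Laplacian of `u`, i.e. the trace of the Hessian `fderiv ℝ (gradient u) x`. -/
noncomputable def lapl {d : ℕ} (u : Euc d → ℝ) (x : Euc d) : ℝ :=
  LinearMap.trace ℝ (Euc d) (fderiv ℝ (gradient u) x).toLinearMap

/-- The divergence of a vector field `F`, i.e. the trace of `fderiv ℝ F x`. -/
noncomputable def diverg {d : ℕ} (F : Euc d → Euc d) (x : Euc d) : ℝ :=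
  LinearMap.trace ℝ (Euc d) (fderiv ℝ F x).toLinearMap

/-- The `L^r(Ω)` norm `(∫_Ω |g|^r dx)^(1/r)` of a scalar function. -/
noncomputable def Lnorm {d : ℕ} (r : ℝ) (Ω : Set (Euc d)) (g : Euc d → ℝ) : ℝ :=
  (∫ x in Ω, |g x| ^ r) ^ (1 / r)

/-- Truncation at level `k`: `T_k(s) = max (-k) (min s k)`. -/
def trunc (k s : ℝ) : ℝ := max (-k) (min s k)

/-- `u` is `C²` on an open neighbourhood of the closure of `Ω`. -/
def C2OnNbhd {d : ℕ} (Ω : Set (Euc d)) (u : Euc d → ℝ) : Prop :=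
  ∃ U : Set (Euc d), IsOpen U ∧ closure Ω ⊆ U ∧ ContDiffOn ℝ 2 u U

/-- Classical solution of the Dirichlet problem
`-Δu + λ u + H(x, Du) = f` in `Ω`, `u = 0` on `∂Ω`. -/
def IsClassicalSol {d : ℕ} (Ω : Set (Euc d)) (lam : ℝ) (H : Euc d → Euc d → ℝ)
    (f : Euc d → ℝ) (u : Euc d → ℝ) : Prop :=
  C2OnNbhd Ω u ∧ (∀ x ∈ frontier Ω, u x = 0) ∧
    ∀ x ∈ Ω, -lapl u x + lam * u x + H x (gradient u x) = f x

/-- The growth condition (H): `C_H⁻¹ |p|^γ - C_H ≤ H(x,p) ≤ C_H(|p|^γ + 1)` on `Ω × ℝ^d`. -/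
def GrowthH {d : ℕ} (Ω : Set (Euc d)) (CH γ : ℝ) (H : Euc d → Euc d → ℝ) : Prop :=
  ∀ x ∈ Ω, ∀ p : Euc d, CH⁻¹ * ‖p‖ ^ γ - CH ≤ H x p ∧ H x p ≤ CH * (‖p‖ ^ γ + 1)

/-- The Calderón–Zygmund estimate holds on `Ω` for exponent `r`, zero-th order
coefficient `lam`, with constant `C₁`. -/
def CZEstimate {d : ℕ} (Ω : Set (Euc d)) (lam r C₁ : ℝ) : Prop :=
  ∀ v : Euc d → ℝ, C2OnNbhd Ω v → (∀ x ∈ frontier Ω, v x = 0) →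
    Lnorm r Ω v + Lnorm r Ω (fun x => ‖gradient v x‖)
        + Lnorm r Ω (fun x => ‖fderiv ℝ (gradient v) x‖)
      ≤ C₁ * Lnorm r Ω (fun x => -lapl v x + lam * v x)

/-- The Gagliardo–Nirenberg inequality on `Ω` for the exponents `(a, r, s, θ)`
with constant `CGN`. -/
def GNIneq {d : ℕ} (Ω : Set (Euc d)) (a r s θ CGN : ℝ) : Prop :=
  ∀ v : Euc d → ℝ, C2OnNbhd Ω v →
    Lnorm a Ω (fun x => ‖gradient v x‖) ≤
      CGN * (Lnorm r Ω v + Lnorm r Ω (fun x => ‖gradient v x‖)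
          + Lnorm r Ω (fun x => ‖fderiv ℝ (gradient v) x‖)) ^ θ
        * (Lnorm s Ω v) ^ (1 - θ)
      + CGN * Lnorm s Ω v

lemma sle_gradient_eq {d : ℕ} (v : Euc d → ℝ) :
    gradient v = fun x => (InnerProductSpace.toDual ℝ (Euc d)).symm (fderiv ℝ v x) := rfl

lemma sle_norm_gradient {d : ℕ} (v : Euc d → ℝ) (x : Euc d) :
    ‖gradient v x‖ = ‖fderiv ℝ v x‖ := by
  rw [sle_gradient_eq]; simp

lemma sle_gradient_contDiff {d : ℕ} {v : Euc d → ℝ} (hv : ContDiff ℝ 2 v) :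
    ContDiff ℝ 1 (gradient v) := by
  rw [sle_gradient_eq]
  exact (InnerProductSpace.toDual ℝ (Euc d)).symm.contDiff.comp
    (hv.fderiv_right (m := 1) (by norm_num))

lemma sle_gradient_continuous {d : ℕ} {v : Euc d → ℝ} (hv : ContDiff ℝ 1 v) :
    Continuous (gradient v) := by
  rw [sle_gradient_eq]
  exact (InnerProductSpace.toDual ℝ (Euc d)).symm.continuous.comp
    (hv.continuous_fderiv (by norm_num))

lemma sle_lapl_eq {d : ℕ} {v : Euc d → ℝ} {x : Euc d}
    (hv : DifferentiableAt ℝ (gradient v) x) :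
    lapl v x = ∑ i, fderiv ℝ (fun y => fderiv ℝ v y (EuclideanSpace.basisFun (Fin d) ℝ i)) x
      (EuclideanSpace.basisFun (Fin d) ℝ i) := by
  unfold lapl
  rw [LinearMap.trace_eq_sum_inner _ (EuclideanSpace.basisFun (Fin d) ℝ)]
  refine Finset.sum_congr rfl fun i _ => ?_
  have h : (fun y => fderiv ℝ v y (EuclideanSpace.basisFun (Fin d) ℝ i))
      = fun y => inner ℝ (EuclideanSpace.basisFun (Fin d) ℝ i) (gradient v y) := by
    funext y
    rw [inner_gradient_right]; simp
  rw [h]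
  have h2 : HasFDerivAt (fun y => inner ℝ (EuclideanSpace.basisFun (Fin d) ℝ i) (gradient v y))
      ((innerSL ℝ (EuclideanSpace.basisFun (Fin d) ℝ i)).comp (fderiv ℝ (gradient v) x)) x :=
    (innerSL ℝ (EuclideanSpace.basisFun (Fin d) ℝ i)).hasFDerivAt.comp x hv.hasFDerivAt
  rw [h2.fderiv]
  simp

lemma sle_lapl_continuous {d : ℕ} {v : Euc d → ℝ} (hv : ContDiff ℝ 2 v) :
    Continuous (lapl v) := by
  have h := (sle_gradient_contDiff hv).continuous_fderiv (by norm_num)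
  have : lapl v = fun x => ∑ i, inner ℝ (EuclideanSpace.basisFun (Fin d) ℝ i)
      (fderiv ℝ (gradient v) x (EuclideanSpace.basisFun (Fin d) ℝ i)) := by
    funext x
    unfold lapl
    rw [LinearMap.trace_eq_sum_inner _ (EuclideanSpace.basisFun (Fin d) ℝ)]
    rfl
  rw [this]
  fun_prop

lemma sle_inner_gradient {d : ℕ} (a v : Euc d → ℝ) (x : Euc d) :
    inner ℝ (gradient a x) (gradient v x) =
      ∑ i, fderiv ℝ a x (EuclideanSpace.basisFun (Fin d) ℝ i)
        * fderiv ℝ v x (EuclideanSpace.basisFun (Fin d) ℝ i) := by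
  rw [← (EuclideanSpace.basisFun (Fin d) ℝ).sum_inner_mul_inner]
  refine Finset.sum_congr rfl fun i _ => ?_
  rw [inner_gradient_left, inner_gradient_right]; simp

lemma sle_ibp {d : ℕ} {a v : Euc d → ℝ} (ha : ContDiff ℝ 1 a) (hac : HasCompactSupport a)
    (hv : ContDiff ℝ 2 v) :
    ∫ x, a x * lapl v x = - ∫ x, inner ℝ (gradient a x) (gradient v x) := by
  have hg := sle_gradient_contDiff hv
  set e := EuclideanSpace.basisFun (Fin d) ℝ with he
  have hgi : ∀ i, ContDiff ℝ 1 (fun y => fderiv ℝ v y (e i)) := fun i =>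
    (hv.fderiv_right (m := 1) (by norm_num)).clm_apply contDiff_const
  have hgi' : ∀ i, Continuous (fun y => fderiv ℝ (fun y => fderiv ℝ v y (e i)) y (e i)) := fun i =>
    ((hgi i).continuous_fderiv (by norm_num)).clm_apply continuous_const
  have hai : ∀ i, Continuous (fun y => fderiv ℝ a y (e i)) := fun i =>
    (ha.continuous_fderiv (by norm_num)).clm_apply continuous_const
  have hac' : ∀ i, HasCompactSupport (fun y => fderiv ℝ a y (e i)) := fun i =>
    hac.fderiv_apply ℝ (e i)
  have i1 : ∀ i, Integrable (fun x => fderiv ℝ a x (e i) * fderiv ℝ v x (e i)) := fun i =>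
    ((hai i).mul (hgi i).continuous).integrable_of_hasCompactSupport ((hac' i).mul_right)
  have i2 : ∀ i, Integrable (fun x => a x * fderiv ℝ (fun y => fderiv ℝ v y (e i)) x (e i)) :=
    fun i => (ha.continuous.mul (hgi' i)).integrable_of_hasCompactSupport hac.mul_right
  have i3 : ∀ i, Integrable (fun x => a x * fderiv ℝ v x (e i)) := fun i =>
    (ha.continuous.mul (hgi i).continuous).integrable_of_hasCompactSupport hac.mul_right
  have l1 : ∀ x, a x * lapl v x
      = ∑ i, a x * fderiv ℝ (fun y => fderiv ℝ v y (e i)) x (e i) := by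
    intro x
    rw [sle_lapl_eq (hg.differentiable (by norm_num) x), Finset.mul_sum]
  simp_rw [l1, sle_inner_gradient]
  rw [integral_finset_sum _ (fun i _ => i2 i), integral_finset_sum _ (fun i _ => i1 i),
    ← Finset.sum_neg_distrib]
  refine Finset.sum_congr rfl fun i _ => ?_
  exact integral_mul_fderiv_eq_neg_fderiv_mul_of_integrable (i1 i) (i2 i) (i3 i)
    (fun x _ => ha.differentiable (by norm_num) x)
    (fun x _ => (hgi i).differentiable (by norm_num) x)

lemma sle_pp_hasDerivAt {m : ℝ} (hm : 1 < m) (t : ℝ) :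
    HasDerivAt (fun t : ℝ => max t 0 ^ m) (m * max t 0 ^ (m - 1)) t := by
  rcases lt_trichotomy t 0 with ht | ht | ht
  · have : (fun t : ℝ => max t 0 ^ m) =ᶠ[nhds t] fun _ => 0 := by
      filter_upwards [gt_mem_nhds ht] with y hy
      rw [max_eq_right hy.le, Real.zero_rpow (by linarith)]
    rw [max_eq_right ht.le, Real.zero_rpow (by linarith), mul_zero]
    exact (hasDerivAt_const t (0:ℝ)).congr_of_eventuallyEq this
  · subst ht
    rw [max_self, Real.zero_rpow (by linarith), mul_zero]
    have h0 : HasDerivAt (fun t : ℝ => |t| ^ m) 0 0 := by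
      simpa using hasDerivAt_abs_rpow (0:ℝ) hm
    rw [hasDerivAt_iff_isLittleO] at h0 ⊢
    refine Asymptotics.IsBigO.trans_isLittleO ?_ h0
    refine Asymptotics.IsBigO.of_bound 1 (Filter.Eventually.of_forall fun y => ?_)
    simp only [max_self, smul_zero, sub_zero, abs_zero, one_mul,
      Real.zero_rpow (show m ≠ 0 by linarith)]
    rw [Real.norm_of_nonneg (by positivity), Real.norm_of_nonneg (by positivity)]
    exact Real.rpow_le_rpow (le_max_right _ _) (max_le (le_abs_self y) (abs_nonneg y)) (by linarith)
  · have : (fun t : ℝ => max t 0 ^ m) =ᶠ[nhds t] fun t => t ^ m := by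
      filter_upwards [lt_mem_nhds ht] with y hy
      rw [max_eq_left hy.le]
    rw [max_eq_left ht.le]
    exact (Real.hasDerivAt_rpow_const (Or.inr hm.le)).congr_of_eventuallyEq this

lemma sle_pp_contDiff {m : ℝ} (hm : 1 < m) : ContDiff ℝ 1 (fun t : ℝ => max t 0 ^ m) := by
  rw [contDiff_one_iff_deriv]
  refine ⟨fun t => (sle_pp_hasDerivAt hm t).differentiableAt, ?_⟩
  have : deriv (fun t : ℝ => max t 0 ^ m) = fun t => m * max t 0 ^ (m - 1) :=
    funext fun t => (sle_pp_hasDerivAt hm t).deriv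
  rw [this]
  exact continuous_const.mul ((continuous_id.max continuous_const).rpow_const
    (fun x => Or.inr (by linarith)))

/-- The truncated function `(w - l)^+` extended by zero outside `Ω`. -/
def sleZ {d : ℕ} (Ω : Set (Euc d)) (w : Euc d → ℝ) (l : ℝ) : Euc d → ℝ :=
  Ω.indicator (fun x => max (w x - l) 0)

lemma sleZ_nonneg {d : ℕ} (Ω : Set (Euc d)) (w : Euc d → ℝ) (l : ℝ) (x : Euc d) :
    0 ≤ sleZ Ω w l x := Set.indicator_nonneg (fun _ _ => le_max_right _ _) x

lemma sleZ_of_mem {d : ℕ} {Ω : Set (Euc d)} (w : Euc d → ℝ) (l : ℝ) {x : Euc d} (hx : x ∈ Ω) :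
    sleZ Ω w l x = max (w x - l) 0 := Set.indicator_of_mem hx _

lemma sleZ_of_notMem {d : ℕ} {Ω : Set (Euc d)} (w : Euc d → ℝ) (l : ℝ) {x : Euc d} (hx : x ∉ Ω) :
    sleZ Ω w l x = 0 := Set.indicator_of_notMem hx _

section Zfacts
variable {d : ℕ} {Ω : Set (Euc d)} {w : Euc d → ℝ} {l : ℝ}

lemma sleZ_K (hΩo : IsOpen Ω) (hΩb : Bornology.IsBounded Ω) (hw : Continuous w)
    (hw0 : ∀ x ∈ frontier Ω, w x = 0) (hl : 0 < l) :
    IsCompact (closure Ω ∩ {x | l ≤ w x}) ∧ closure Ω ∩ {x | l ≤ w x} ⊆ Ω := by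
  constructor
  · exact hΩb.isCompact_closure.inter_right (isClosed_le continuous_const hw)
  · rintro x ⟨hx, hxl⟩
    by_contra hxo
    have : x ∈ frontier Ω := by rw [hΩo.frontier_eq]; exact ⟨hx, hxo⟩
    have h0 := hw0 x this
    simp only [Set.mem_setOf_eq] at hxl
    linarith

lemma sleZ_eq_zero {x : Euc d} (hx : x ∉ closure Ω ∩ {x | l ≤ w x}) : sleZ Ω w l x = 0 := by
  by_cases h : x ∈ Ω
  · rw [sleZ_of_mem _ _ h, max_eq_right]
    by_contra hc
    exact hx ⟨subset_closure h, by simp only [Set.mem_setOf_eq]; linarith⟩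
  · exact sleZ_of_notMem _ _ h

lemma sleZ_local (hΩo : IsOpen Ω) (hΩb : Bornology.IsBounded Ω) (hw : Continuous w)
    (hw0 : ∀ x ∈ frontier Ω, w x = 0) (hl : 0 < l) (x : Euc d) :
    (x ∈ Ω ∧ sleZ Ω w l =ᶠ[nhds x] fun y => max (w y - l) 0) ∨
    (sleZ Ω w l =ᶠ[nhds x] fun _ => 0) := by
  obtain ⟨hK, hKΩ⟩ := sleZ_K hΩo hΩb hw hw0 hl
  by_cases hx : x ∈ Ω
  · left
    refine ⟨hx, ?_⟩
    filter_upwards [hΩo.mem_nhds hx] with y hy using sleZ_of_mem _ _ hy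
  · right
    filter_upwards [hK.isClosed.isOpen_compl.mem_nhds (fun h => hx (hKΩ h))] with y hy
    exact sleZ_eq_zero hy

lemma sleZ_continuous (hΩo : IsOpen Ω) (hΩb : Bornology.IsBounded Ω) (hw : Continuous w)
    (hw0 : ∀ x ∈ frontier Ω, w x = 0) (hl : 0 < l) : Continuous (sleZ Ω w l) := by
  rw [continuous_iff_continuousAt]
  intro x
  rcases sleZ_local hΩo hΩb hw hw0 hl x with ⟨_, h⟩ | h
  · refine ContinuousAt.congr ?_ h.symm
    fun_prop
  · exact continuousAt_const.congr h.symm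

lemma sleZ_hasCompactSupport (hΩo : IsOpen Ω) (hΩb : Bornology.IsBounded Ω) (hw : Continuous w)
    (hw0 : ∀ x ∈ frontier Ω, w x = 0) (hl : 0 < l) : HasCompactSupport (sleZ Ω w l) :=
  HasCompactSupport.intro (sleZ_K hΩo hΩb hw hw0 hl).1 fun _ hx => sleZ_eq_zero hx

lemma sleZ_rpow_hcs (hΩo : IsOpen Ω) (hΩb : Bornology.IsBounded Ω) (hw : Continuous w)
    (hw0 : ∀ x ∈ frontier Ω, w x = 0) (hl : 0 < l) {m : ℝ} (hm : 0 < m) :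
    HasCompactSupport (fun x => sleZ Ω w l x ^ m) :=
  (sleZ_hasCompactSupport hΩo hΩb hw hw0 hl).comp_left (g := fun t : ℝ => t ^ m)
    (Real.zero_rpow hm.ne')

lemma sleZ_rpow_cont (hΩo : IsOpen Ω) (hΩb : Bornology.IsBounded Ω) (hw : Continuous w)
    (hw0 : ∀ x ∈ frontier Ω, w x = 0) (hl : 0 < l) {m : ℝ} (hm : 0 < m) :
    Continuous (fun x => sleZ Ω w l x ^ m) :=
  (sleZ_continuous hΩo hΩb hw hw0 hl).rpow_const fun _ => Or.inr hm.le

lemma sleZ_rpow_contDiff (hΩo : IsOpen Ω) (hΩb : Bornology.IsBounded Ω) (hw : ContDiff ℝ 2 w)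
    (hw0 : ∀ x ∈ frontier Ω, w x = 0) (hl : 0 < l) {m : ℝ} (hm : 1 < m) :
    ContDiff ℝ 1 (fun x => sleZ Ω w l x ^ m) := by
  rw [contDiff_iff_contDiffAt]
  intro x
  rcases sleZ_local hΩo hΩb hw.continuous hw0 hl x with ⟨_, h⟩ | h
  · have h2 : (fun x => sleZ Ω w l x ^ m) =ᶠ[nhds x] fun y => max (w y - l) 0 ^ m := by
      filter_upwards [h] with y hy; rw [hy]
    refine ContDiffAt.congr_of_eventuallyEq ?_ h2
    have := (sle_pp_contDiff hm).comp ((hw.of_le (by norm_num : (1:WithTop ℕ∞) ≤ 2)).sub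
      (contDiff_const (c := l)))
    exact this.contDiffAt
  · have h2 : (fun x => sleZ Ω w l x ^ m) =ᶠ[nhds x] fun y => 0 := by
      filter_upwards [h] with y hy; rw [hy, Real.zero_rpow (by linarith)]
    exact contDiffAt_const.congr_of_eventuallyEq h2

lemma sleZ_rpow_fderiv (hΩo : IsOpen Ω) (hΩb : Bornology.IsBounded Ω) (hw : ContDiff ℝ 2 w)
    (hw0 : ∀ x ∈ frontier Ω, w x = 0) (hl : 0 < l) {m : ℝ} (hm : 1 < m) (x : Euc d) :
    fderiv ℝ (fun x => sleZ Ω w l x ^ m) x = (m * sleZ Ω w l x ^ (m - 1)) • fderiv ℝ w x := by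
  rcases sleZ_local hΩo hΩb hw.continuous hw0 hl x with ⟨_, h⟩ | h
  · have h2 : (fun x => sleZ Ω w l x ^ m) =ᶠ[nhds x] fun y => max (w y - l) 0 ^ m := by
      filter_upwards [h] with y hy; rw [hy]
    rw [h2.fderiv_eq, h.eq_of_nhds]
    have hd : HasFDerivAt (fun y => w y - l) (fderiv ℝ w x) x :=
      ((hw.differentiable (by norm_num)) x).hasFDerivAt.sub_const l
    exact ((sle_pp_hasDerivAt hm (w x - l)).comp_hasFDerivAt x hd).fderiv
  · have h2 : (fun x => sleZ Ω w l x ^ m) =ᶠ[nhds x] fun y => 0 := by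
      filter_upwards [h] with y hy; rw [hy, Real.zero_rpow (by linarith)]
    rw [h2.fderiv_eq, h.eq_of_nhds, Real.zero_rpow (by linarith)]
    simp

lemma sleZ_rpow_gradient (hΩo : IsOpen Ω) (hΩb : Bornology.IsBounded Ω) (hw : ContDiff ℝ 2 w)
    (hw0 : ∀ x ∈ frontier Ω, w x = 0) (hl : 0 < l) {m : ℝ} (hm : 1 < m) (x : Euc d) :
    gradient (fun x => sleZ Ω w l x ^ m) x = (m * sleZ Ω w l x ^ (m - 1)) • gradient w x := by
  rw [sle_gradient_eq, sle_gradient_eq]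
  simp only
  rw [sleZ_rpow_fderiv hΩo hΩb hw hw0 hl hm]
  simp

end Zfacts

lemma sle_young {a b : ℝ} (ha : 0 < a) (hab : a < b) (ε : ℝ) (hε : 0 < ε) :
    ∃ C : ℝ, 0 < C ∧ ∀ x : ℝ, 0 ≤ x → x ^ a ≤ ε * x ^ b + C := by
  set X : ℝ := ε ^ (-(1 / (b - a))) with hX
  have hX0 : 0 < X := Real.rpow_pos_of_pos hε _
  refine ⟨X ^ a, Real.rpow_pos_of_pos hX0 _, fun x hx => ?_⟩
  rcases le_total x X with h | h
  · have h1 : x ^ a ≤ X ^ a := Real.rpow_le_rpow hx h ha.le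
    have h2 : 0 ≤ ε * x ^ b := by positivity
    linarith
  · have hx0 : 0 < x := hX0.trans_le h
    have h1 : x ^ (a - b) ≤ ε := by
      have h2 : x ^ (a - b) ≤ X ^ (a - b) :=
        Real.rpow_le_rpow_of_nonpos hX0 h (by linarith)
      have h3 : X ^ (a - b) = ε := by
        rw [hX, ← Real.rpow_mul hε.le]
        have : -(1 / (b - a)) * (a - b) = 1 := by
          have : b - a ≠ 0 := by linarith
          field_simp; ring
        rw [this, Real.rpow_one]
      linarith
    have h4 : x ^ a = x ^ (a - b) * x ^ b := by
      rw [← Real.rpow_add hx0]; congr 1; ring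
    have h5 : 0 ≤ X ^ a := by positivity
    rw [h4]
    have := mul_le_mul_of_nonneg_right h1 (Real.rpow_nonneg hx b)
    linarith

lemma sle_convex_bound {d : ℕ} {CH γ : ℝ} (hCH : 0 < CH) (hγ1 : 1 < γ) (hγ2 : γ < 2)
    (δ : ℝ) (hδ : 0 < δ) :
    ∃ C : ℝ, 0 < C ∧ ∀ h : Euc d → ℝ, ConvexOn ℝ Set.univ h →
      (∀ p, -CH ≤ h p ∧ h p ≤ CH * (‖p‖ ^ γ + 1)) →
      ∀ p p', h p - h p' ≤ (δ * ‖p‖ + C) * ‖p' - p‖ := by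
  obtain ⟨C0, hC0, hY⟩ := sle_young (a := γ - 1) (b := 1) (by linarith) (by linarith)
    (δ / (6 * CH)) (by positivity)
  refine ⟨δ + 6 * CH * C0, by positivity, fun h hc hg p p' => ?_⟩
  rcases eq_or_ne p' p with rfl | hne
  · simp
  have he : 0 < ‖p' - p‖ := norm_pos_iff.mpr (sub_ne_zero.mpr hne)
  set R : ℝ := 1 + ‖p‖ with hR
  have hR1 : 1 ≤ R := by have := norm_nonneg p; linarith
  set t : ℝ := R / ‖p' - p‖ with ht
  have ht0 : 0 < t := by positivity
  have ha1 : 0 ≤ 1 / (1 + t) := by positivity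
  have ha2 : 0 ≤ t / (1 + t) := by positivity
  have ha3 : 1 / (1 + t) + t / (1 + t) = 1 := by field_simp
  have hconv := hc.2 (Set.mem_univ (p - t • (p' - p))) (Set.mem_univ p') ha1 ha2 ha3
  have hpt : (1 / (1 + t)) • (p - t • (p' - p)) + (t / (1 + t)) • p' = p := by
    have h1 : (1 / (1 + t)) • (p - t • (p' - p)) + (t / (1 + t)) • p'
        = (1 / (1 + t) * (1 + t)) • p := by
      module
    rw [h1, one_div_mul_cancel (by positivity), one_smul]
  rw [hpt] at hconv
  simp only [smul_eq_mul] at hconv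
  have h2 : (1 + t) * h p ≤ h (p - t • (p' - p)) + t * h p' := by
    have := mul_le_mul_of_nonneg_left hconv (show 0 ≤ 1 + t by positivity)
    have h3 : (1 + t) * (1 / (1 + t) * h (p - t • (p' - p)) + t / (1 + t) * h p')
      = h (p - t • (p' - p)) + t * h p' := by field_simp
    linarith
  have hn : ‖p - t • (p' - p)‖ ≤ 2 * R := by
    calc ‖p - t • (p' - p)‖ ≤ ‖p‖ + ‖t • (p' - p)‖ := norm_sub_le _ _
      _ = ‖p‖ + R := by
        rw [norm_smul, Real.norm_of_nonneg ht0.le, ht, div_mul_cancel₀ _ he.ne']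
      _ ≤ 2 * R := by linarith
  have h4 : ‖p - t • (p' - p)‖ ^ γ ≤ 4 * (R * R ^ (γ - 1)) := by
    calc ‖p - t • (p' - p)‖ ^ γ ≤ (2 * R) ^ γ := Real.rpow_le_rpow (norm_nonneg _) hn (by linarith)
      _ = 2 ^ γ * R ^ γ := Real.mul_rpow (by norm_num) (by linarith)
      _ ≤ 2 ^ (2:ℝ) * R ^ γ := by
        gcongr
        norm_num
      _ = 4 * (R * R ^ (γ - 1)) := by
        rw [← Real.rpow_one_add' (by linarith) (by linarith)]
        norm_num
  have h5 := (hg (p - t • (p' - p))).2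
  have h6 := (hg p).1
  have h7 : 1 ≤ R ^ (γ - 1) := Real.one_le_rpow hR1 (by linarith)
  have h8 : t * (h p - h p') ≤ 6 * CH * (R * R ^ (γ - 1)) := by
    have : 1 ≤ R * R ^ (γ - 1) := by nlinarith
    nlinarith
  have h9 : R * (h p - h p') ≤ R * (6 * CH * R ^ (γ - 1) * ‖p' - p‖) := by
    have : R * (h p - h p') = t * (h p - h p') * ‖p' - p‖ := by
      rw [ht]; field_simp
    rw [this]
    have := mul_le_mul_of_nonneg_right h8 he.le
    linarith
  have h10 := le_of_mul_le_mul_left h9 (by linarith)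
  refine h10.trans (mul_le_mul_of_nonneg_right ?_ he.le)
  have h11 := hY R (by linarith)
  rw [Real.rpow_one] at h11
  calc 6 * CH * R ^ (γ - 1) ≤ 6 * CH * (δ / (6 * CH) * R + C0) := by gcongr
    _ = δ * R + 6 * CH * C0 := by field_simp
    _ = δ * ‖p‖ + (δ + 6 * CH * C0) := by rw [hR]; ring

lemma sle_localMax {d : ℕ} {v : Euc d → ℝ} (hv : ContDiff ℝ 2 v) {x : Euc d}
    (hx : IsLocalMax v x) : gradient v x = 0 ∧ lapl v x ≤ 0 := by
  constructor
  · rw [← norm_eq_zero, sle_norm_gradient, hx.fderiv_eq_zero, norm_zero]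
  rw [sle_lapl_eq ((sle_gradient_contDiff hv).differentiable (by norm_num) x)]
  refine Finset.sum_nonpos fun i _ => ?_
  set e := EuclideanSpace.basisFun (Fin d) ℝ i
  have hline : ∀ t : ℝ, HasDerivAt (fun t : ℝ => x + t • e) e t := fun t => by
    simpa using ((hasDerivAt_id t).smul_const e).const_add x
  have hD1 : ∀ t : ℝ, HasDerivAt (fun t : ℝ => v (x + t • e)) (fderiv ℝ v (x + t • e) e) t :=
    fun t => ((hv.differentiable (by norm_num)) _).hasFDerivAt.comp_hasDerivAt t (hline t)
  have hgi : ContDiff ℝ 1 (fun y => fderiv ℝ v y e) :=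
    (hv.fderiv_right (m := 1) (by norm_num)).clm_apply contDiff_const
  have hderiv : deriv (fun t : ℝ => v (x + t • e)) = fun t => fderiv ℝ v (x + t • e) e :=
    funext fun t => (hD1 t).deriv
  have hD2 : HasDerivAt (fun t : ℝ => fderiv ℝ v (x + t • e) e)
      (fderiv ℝ (fun y => fderiv ℝ v y e) x e) 0 := by
    have := (((hgi.differentiable (by norm_num)) (x + (0:ℝ) • e)).hasFDerivAt.comp_hasDerivAt
      (0:ℝ) (hline 0))
    rw [zero_smul, add_zero] at this
    exact this
  have hdd : deriv (deriv (fun t : ℝ => v (x + t • e))) 0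
      = fderiv ℝ (fun y => fderiv ℝ v y e) x e := by rw [hderiv]; exact hD2.deriv
  by_contra hpos
  push Not at hpos
  have hmin : IsLocalMin (fun t : ℝ => v (x + t • e)) 0 := by
    apply isLocalMin_of_deriv_deriv_pos
    · rw [hdd]; exact hpos
    · rw [hderiv]; simp [hx.fderiv_eq_zero]
    · exact (hD1 0).continuousAt
  have hmax : IsLocalMax (fun t : ℝ => v (x + t • e)) 0 := by
    have ht : Filter.Tendsto (fun t : ℝ => x + t • e) (nhds 0) (nhds x) := by
      have := (hline 0).continuousAt.tendsto
      simpa using this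
    have := ht.eventually hx
    filter_upwards [this] with t ht
    simpa using ht
  have hconst : (fun t : ℝ => v (x + t • e)) =ᶠ[nhds 0] fun _ => v (x + (0:ℝ) • e) := by
    filter_upwards [hmin, hmax] with t h1 h2 using le_antisymm h2 h1
  have := hconst.deriv.deriv_eq
  rw [hdd] at this
  simp at this
  linarith

lemma sle_sup_bound {d : ℕ} {Ω : Set (Euc d)} (hΩo : IsOpen Ω) (hΩb : Bornology.IsBounded Ω)
    {v : Euc d → ℝ} (hv : ContDiff ℝ 2 v) (hv0 : ∀ x ∈ frontier Ω, v x = 0) {A lam : ℝ}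
    (hlam : 0 < lam) (hA : 0 ≤ A)
    (h : ∀ x ∈ Ω, gradient v x = 0 → lapl v x ≤ 0 → lam * v x ≤ A) :
    ∀ x ∈ Ω, v x ≤ A / lam := by
  intro x hx
  obtain ⟨x0, hx0, hmax⟩ := hΩb.isCompact_closure.exists_isMaxOn ⟨x, subset_closure hx⟩
    hv.continuous.continuousOn
  have h1 : v x ≤ v x0 := hmax (subset_closure hx)
  refine h1.trans ?_
  by_cases hx0Ω : x0 ∈ Ω
  · have hloc : IsLocalMax v x0 := by
      filter_upwards [hΩo.mem_nhds hx0Ω] with y hy using hmax (subset_closure hy)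
    obtain ⟨hg, hl⟩ := sle_localMax hv hloc
    rw [le_div_iff₀ hlam]
    linarith [h x0 hx0Ω hg hl]
  · have : x0 ∈ frontier Ω := by rw [hΩo.frontier_eq]; exact ⟨hx0, hx0Ω⟩
    rw [hv0 x0 this]
    positivity

lemma sle_gradient_neg {d : ℕ} (v : Euc d → ℝ) (x : Euc d) :
    gradient (fun x => - v x) x = - gradient v x := by
  simp only [sle_gradient_eq, fderiv_fun_neg, map_neg]

lemma sle_gradient_sub {d : ℕ} {u v : Euc d → ℝ} {x : Euc d} (hu : DifferentiableAt ℝ u x)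
    (hv : DifferentiableAt ℝ v x) :
    gradient (fun x => u x - v x) x = gradient u x - gradient v x := by
  simp only [sle_gradient_eq, fderiv_fun_sub hu hv, map_sub]

lemma sle_lapl_neg {d : ℕ} (v : Euc d → ℝ) (x : Euc d) :
    lapl (fun x => - v x) x = - lapl v x := by
  unfold lapl
  have : gradient (fun x => - v x) = fun x => - gradient v x := funext (sle_gradient_neg v)
  rw [this, fderiv_fun_neg]
  simp

lemma sle_lapl_sub {d : ℕ} {u v : Euc d → ℝ} (hu : ContDiff ℝ 2 u) (hv : ContDiff ℝ 2 v)
    (x : Euc d) :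
    lapl (fun x => u x - v x) x = lapl u x - lapl v x := by
  unfold lapl
  have : gradient (fun x => u x - v x) = fun x => gradient u x - gradient v x :=
    funext fun x => sle_gradient_sub (hu.differentiable (by norm_num) x)
      (hv.differentiable (by norm_num) x)
  rw [this, fderiv_fun_sub ((sle_gradient_contDiff hu).differentiable (by norm_num) x)
    ((sle_gradient_contDiff hv).differentiable (by norm_num) x)]
  simp

lemma sle_abs_bound {d : ℕ} {Ω : Set (Euc d)} (hΩo : IsOpen Ω) (hΩb : Bornology.IsBounded Ω)
    {v : Euc d → ℝ} (hv : ContDiff ℝ 2 v) {lam CH γ M : ℝ} {H : Euc d → Euc d → ℝ}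
    {f : Euc d → ℝ} (hs : IsClassicalSol Ω lam H f v)
    (hlam : 0 < lam) (hCH : 0 < CH) (hγ : 0 < γ) (hH : GrowthH Ω CH γ H)
    (hM : 0 ≤ M) (hf : ∀ x ∈ Ω, |f x| ≤ M) :
    ∀ x ∈ Ω, |v x| ≤ (M + CH) / lam := by
  obtain ⟨-, h0, heq⟩ := hs
  have hH0 : ∀ x ∈ Ω, |H x 0| ≤ CH := by
    intro x hx
    have := hH x hx 0
    rw [norm_zero, Real.zero_rpow hγ.ne'] at this
    rw [abs_le]; constructor <;> linarith
  intro x hx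
  rw [abs_le]
  constructor
  · have := sle_sup_bound hΩo hΩb (v := fun x => - v x) hv.neg (fun x hx => by simp [h0 x hx]) hlam
      (A := M + CH) (by linarith) ?_ x hx
    · linarith
    · intro y hy hg hl
      have e1 := sle_gradient_neg v y
      have e2 := sle_lapl_neg v y
      have hg' : gradient v y = 0 := by
        rw [← neg_eq_zero, ← e1]; exact hg
      have hl' : - lapl v y ≤ 0 := by rw [← e2]; exact hl
      have := heq y hy
      rw [hg'] at this
      have h3 := abs_le.mp (hf y hy)
      have h4 := abs_le.mp (hH0 y hy)
      linarith
  · refine sle_sup_bound hΩo hΩb hv h0 hlam (A := M + CH) (by linarith) ?_ x hx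
    intro y hy hg hl
    have := heq y hy
    rw [hg] at this
    have h3 := abs_le.mp (hf y hy)
    have h4 := abs_le.mp (hH0 y hy)
    linarith

lemma sle_ext {d : ℕ} {Ω : Set (Euc d)} (hΩb : Bornology.IsBounded Ω) {u : Euc d → ℝ}
    (hu : C2OnNbhd Ω u) :
    ∃ v : Euc d → ℝ, ContDiff ℝ 2 v ∧ ∃ V, IsOpen V ∧ closure Ω ⊆ V ∧ Set.EqOn v u V := by
  obtain ⟨U, hUo, hΩU, hUu⟩ := hu
  obtain ⟨δ, hδ, hδU⟩ := hΩb.isCompact_closure.exists_cthickening_subset_open hUo hΩU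
  obtain ⟨χ, hχ, -, hsupp, hone⟩ := exists_contMDiff_support_eq_eq_one_iff
    (modelWithCornersSelf ℝ (Euc d)) (n := 2) (s := Metric.thickening δ (closure Ω))
    (t := Metric.cthickening (δ / 2) (closure Ω)) Metric.isOpen_thickening
    Metric.isClosed_cthickening
    (Metric.cthickening_subset_thickening' hδ (by linarith) _)
  have hχ2 : ContDiff ℝ 2 χ := hχ.contDiff
  refine ⟨fun x => χ x * u x, ?_, Metric.thickening (δ / 2) (closure Ω),
    Metric.isOpen_thickening, Metric.self_subset_thickening (by linarith) _, ?_⟩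
  · rw [contDiff_iff_contDiffAt]
    intro x
    by_cases hx : x ∈ U
    · exact hχ2.contDiffAt.mul (hUu.contDiffAt (hUo.mem_nhds hx))
    · have hx' : x ∉ Metric.cthickening δ (closure Ω) := fun h => hx (hδU h)
      have : (fun x => χ x * u x) =ᶠ[nhds x] fun _ => 0 := by
        filter_upwards [Metric.isClosed_cthickening.isOpen_compl.mem_nhds hx'] with y hy
        have : y ∉ Function.support χ := by
          rw [hsupp]; exact fun h => hy (Metric.thickening_subset_cthickening _ _ h)
        rw [Function.notMem_support.mp this, zero_mul]
      exact contDiffAt_const.congr_of_eventuallyEq this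
  · intro x hx
    have := (hone x).mp (Metric.thickening_subset_cthickening _ _ hx)
    simp [this]

lemma sle_ext_sol {d : ℕ} {Ω : Set (Euc d)} (hΩb : Bornology.IsBounded Ω) {u : Euc d → ℝ}
    {lam : ℝ} {H : Euc d → Euc d → ℝ} {f : Euc d → ℝ} (hu : IsClassicalSol Ω lam H f u) :
    ∃ v : Euc d → ℝ, ContDiff ℝ 2 v ∧ IsClassicalSol Ω lam H f v ∧ ∀ x ∈ Ω, v x = u x := by
  obtain ⟨v, hv, V, hVo, hΩV, hE⟩ := sle_ext hΩb hu.1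
  refine ⟨v, hv, ⟨⟨Set.univ, isOpen_univ, Set.subset_univ _, hv.contDiffOn⟩, ?_, ?_⟩,
    fun x hx => hE (hΩV (subset_closure hx))⟩
  · intro x hx
    rw [hE (hΩV (frontier_subset_closure hx)), hu.2.1 x hx]
  · intro x hx
    have h : v =ᶠ[nhds x] u := by
      filter_upwards [hVo.mem_nhds (hΩV (subset_closure hx))] with y hy using hE hy
    have h1 : gradient v =ᶠ[nhds x] gradient u := h.gradient
    have h2 : lapl v x = lapl u x := by unfold lapl; rw [h1.fderiv_eq]
    rw [h2, h.eq_of_nhds, h1.eq_of_nhds]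
    exact hu.2.2 x hx

lemma sle_sobolev (d : ℕ) (hd : 2 < d) :
    ∃ S : ℝ, 0 < S ∧ ∀ φ : Euc d → ℝ, ContDiff ℝ 1 φ → HasCompactSupport φ →
      (∫ x, |φ x| ^ (2 * (d:ℝ) / (d - 2))) ^ (((d:ℝ) - 2) / d) ≤ S * ∫ x, ‖fderiv ℝ φ x‖ ^ 2 := by
  have hd' : (2:ℝ) < d := by exact_mod_cast hd
  have hr : (0:ℝ) < 2 * (d:ℝ) / (d - 2) := div_pos (by linarith) (by linarith)
  set r : NNReal := ⟨2 * (d:ℝ) / (d - 2), hr.le⟩ with hrdef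
  have hrc : (r : ℝ) = 2 * (d:ℝ) / (d - 2) := rfl
  set K : NNReal := eLpNormLESNormFDerivOfEqInnerConst (volume : Measure (Euc d)) ((2:NNReal):ℝ)
    with hK
  refine ⟨(K:ℝ) ^ 2 + 1, by positivity, fun φ hφ hc => ?_⟩
  have hs := eLpNorm_le_eLpNorm_fderiv_of_eq_inner (volume : Measure (Euc d)) hφ hc (p := 2)
    (p' := r) (by norm_num) (by simp; omega) (by
      rw [hrc]; simp
      have : (d:ℝ) - 2 ≠ 0 := by linarith
      field_simp)
  have m1 : MemLp φ r := hφ.continuous.memLp_of_hasCompactSupport hc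
  have hf : Continuous (fderiv ℝ φ) := hφ.continuous_fderiv (by norm_num)
  have m2 : MemLp (fderiv ℝ φ) 2 (volume : Measure (Euc d)) :=
    hf.memLp_of_hasCompactSupport (hc.fderiv ℝ)
  have hr0 : (r : ENNReal) ≠ 0 := by
    have : r ≠ 0 := by
      intro h; rw [h] at hrc; simp at hrc; linarith
    exact_mod_cast this
  rw [m1.eLpNorm_eq_integral_rpow_norm hr0 (by simp)] at hs
  rw [show ((2:NNReal):ENNReal) = 2 by norm_num] at hs
  rw [m2.eLpNorm_eq_integral_rpow_norm (by norm_num) (by norm_num)] at hs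
  rw [← hK, ← ENNReal.ofReal_coe_nnreal (p := K), ← ENNReal.ofReal_mul (by positivity),
    ENNReal.ofReal_le_ofReal_iff (by positivity)] at hs
  simp only [ENNReal.coe_toReal, ENNReal.toReal_ofNat, Real.norm_eq_abs, hrc] at hs
  set P := ∫ x, |φ x| ^ (2 * (d:ℝ) / (d - 2)) with hP
  have hP0 : 0 ≤ P := integral_nonneg fun x => by positivity
  have e2 : (∫ x, ‖fderiv ℝ φ x‖ ^ (2:ℝ)) = ∫ x, ‖fderiv ℝ φ x‖ ^ 2 := by
    simp
  rw [e2] at hs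
  set D := ∫ x, ‖fderiv ℝ φ x‖ ^ 2 with hD
  have hD0 : 0 ≤ D := integral_nonneg fun x => by positivity
  have h2 : (P ^ (2 * (d:ℝ) / (d - 2))⁻¹) ^ 2 ≤ ((K:ℝ) * D ^ (2:ℝ)⁻¹) ^ 2 := by
    gcongr
  have e3 : (P ^ (2 * (d:ℝ) / (d - 2))⁻¹) ^ 2 = P ^ (((d:ℝ) - 2) / d) := by
    rw [← Real.rpow_natCast, ← Real.rpow_mul hP0]
    congr 1
    have : (d:ℝ) - 2 ≠ 0 := by linarith
    push_cast
    field_simp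
  have e4 : ((K:ℝ) * D ^ (2:ℝ)⁻¹) ^ 2 = (K:ℝ)^2 * D := by
    rw [mul_pow]
    congr 1
    rw [← Real.rpow_natCast, ← Real.rpow_mul hD0]; norm_num
  rw [e3, e4] at h2
  nlinarith

lemma sle_aux1 (z a n : ℝ) : z * (a * n) ≤ (1 / 2) * n ^ 2 + (1 / 2) * (z * a) ^ 2 := by
  nlinarith [sq_nonneg (n - z * a)]

lemma sle_aux2 (z δ m C : ℝ) : (1 / 2) * (z * (δ * m + C)) ^ 2
    ≤ δ ^ 2 * (z ^ 2 * m ^ 2) + C ^ 2 * z ^ 2 := by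
  nlinarith [sq_nonneg (z * (δ * m - C))]

lemma sle_aux3 (z s M n m : ℝ) : z * (s * (M * (n * m)))
    ≤ (1 / 4) * (z ^ 2 * m ^ 2) + s ^ 2 * M ^ 2 * n ^ 2 := by
  nlinarith [sq_nonneg ((1 / 2) * (z * m) - s * M * n)]

set_option maxHeartbeats 1600000 in
/-- Energy inequality for the difference of two solutions, tested by `((w - l)^+)^(s-1)`. -/
lemma sle_energy {d : ℕ} {γ lam CH M s : ℝ} (hγ1 : 1 < γ) (hγ2 : γ < 2) (hlam : 0 < lam)
    (hCH : 0 < CH) (hM : 0 ≤ M) (hs : 2 < s) :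
    ∃ C3 : ℝ, 0 < C3 ∧ ∀ (Ω : Set (Euc d)) (H : Euc d → Euc d → ℝ) (f1 f2 v1 v2 g : Euc d → ℝ)
      (l : ℝ), IsOpen Ω → Bornology.IsBounded Ω → GrowthH Ω CH γ H →
      (∀ x ∈ Ω, ConvexOn ℝ Set.univ (H x)) → (∀ x ∈ Ω, |f2 x| ≤ M) →
      ContDiff ℝ 2 v1 → ContDiff ℝ 2 v2 →
      IsClassicalSol Ω lam H f1 v1 → IsClassicalSol Ω lam H f2 v2 →
      (∀ x ∈ Ω, |f1 x - f2 x| ≤ g x) → 0 < l →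
      Integrable (fun x => g x * sleZ Ω (fun x => v1 x - v2 x) l x ^ (s - 1)) →
      (1 / 4) * (∫ x, sleZ Ω (fun x => v1 x - v2 x) l x ^ (s - 2)
          * ‖gradient (fun x => v1 x - v2 x) x‖ ^ 2)
        + lam * l * (∫ x, sleZ Ω (fun x => v1 x - v2 x) l x ^ (s - 1))
      ≤ (∫ x, g x * sleZ Ω (fun x => v1 x - v2 x) l x ^ (s - 1))
        + C3 * ∫ x, sleZ Ω (fun x => v1 x - v2 x) l x ^ s := by
  set M0 : ℝ := (M + CH) / lam with hM0
  have hM0p : 0 < M0 := by positivity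
  set δ : ℝ := 1 / (4 * s * M0) with hδ
  have hs0 : 0 < s := by linarith
  have hδp : 0 < δ := by positivity
  obtain ⟨Cδ, hCδ, hconv⟩ := sle_convex_bound (d := d) hCH hγ1 hγ2 δ hδp
  obtain ⟨C0, hC0, hY⟩ := sle_young (a := γ) (b := 2) (by linarith) hγ2
    (1 / (4 * M0 * CH)) (by positivity)
  set C' : ℝ := M0 * (lam * M0 + M + CH * (C0 + 1)) with hC'
  have hC'p : 0 < C' := by positivity
  refine ⟨2 * C' * δ ^ 2 + Cδ ^ 2, by positivity, ?_⟩
  intro Ω H f1 f2 v1 v2 g l hΩo hΩb hH hHc hf2 hv1 hv2 hs1 hs2 hg hl hgi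
  set w : Euc d → ℝ := fun x => v1 x - v2 x with hw
  have hwC : ContDiff ℝ 2 w := hv1.sub hv2
  have hw0 : ∀ x ∈ frontier Ω, w x = 0 := fun x hx => by
    simp only [hw]; rw [hs1.2.1 x hx, hs2.2.1 x hx, sub_zero]
  have hv2b : ∀ x ∈ Ω, |v2 x| ≤ M0 :=
    sle_abs_bound hΩo hΩb hv2 hs2 hlam hCH (by linarith) hH hM hf2
  set z : Euc d → ℝ := sleZ Ω w l with hz
  have hz0 : ∀ x, 0 ≤ z x := sleZ_nonneg Ω w l
  have hzint : ∀ {m : ℝ} (_ : 0 < m) {h : Euc d → ℝ} (_ : Continuous h),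
      Integrable (fun x => z x ^ m * h x) := by
    intro m hm h hh
    exact ((sleZ_rpow_cont hΩo hΩb hwC.continuous hw0 hl hm).mul hh).integrable_of_hasCompactSupport
      ((sleZ_rpow_hcs hΩo hΩb hwC.continuous hw0 hl hm).mul_right)
  have hgw : Continuous (gradient w) := (sle_gradient_contDiff hwC).continuous
  have hgv : Continuous (gradient v2) := (sle_gradient_contDiff hv2).continuous
  have hlw : Continuous (lapl w) := sle_lapl_continuous hwC
  have hlv : Continuous (lapl v2) := sle_lapl_continuous hv2
  -- powers
  have hp1 : ∀ x, z x ^ (s - 1) = z x ^ (s - 2) * z x := fun x => by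
    rw [← Real.rpow_add_one' (hz0 x) (by linarith)]; congr 1; ring
  have hp2 : ∀ x, z x ^ s = z x ^ (s - 2) * z x ^ 2 := fun x => by
    rw [← Real.rpow_natCast, ← Real.rpow_add' (hz0 x) (by norm_num; linarith)]; congr 1
    push_cast; ring
  -- first test
  have iE : Integrable (fun x => z x ^ (s - 2) * ‖gradient w x‖ ^ 2) :=
    hzint (by linarith) (hgw.norm.pow 2)
  have iD : Integrable (fun x => z x ^ s * ‖gradient v2 x‖ ^ 2) :=
    hzint (by linarith) (hgv.norm.pow 2)
  have iQ : Integrable (fun x => z x ^ s) := by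
    simpa using hzint (m := s) (by linarith) (h := fun _ => 1) continuous_const
  have iR : Integrable (fun x => z x ^ (s - 1)) := by
    simpa using hzint (m := s - 1) (by linarith) (h := fun _ => 1) continuous_const
  have iRl : Integrable (fun x => z x ^ (s - 1) * lapl w x) := hzint (by linarith) hlw
  have iQl : Integrable (fun x => z x ^ s * (v2 x * lapl v2 x)) :=
    hzint (by linarith) (hv2.continuous.mul hlv)
  have iX : Integrable (fun x => z x ^ (s - 1) * (v2 x * inner ℝ (gradient w x) (gradient v2 x))) :=
    hzint (by linarith) (hv2.continuous.mul (hgw.inner hgv))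
  set E := ∫ x, z x ^ (s - 2) * ‖gradient w x‖ ^ 2 with hE
  set D := ∫ x, z x ^ s * ‖gradient v2 x‖ ^ 2 with hD
  set Q := ∫ x, z x ^ s with hQ
  set R := ∫ x, z x ^ (s - 1) with hR
  set GR := ∫ x, g x * z x ^ (s - 1) with hGR
  have id1 : ∫ x, z x ^ (s - 1) * lapl w x = - ((s - 1) * E) := by
    rw [sle_ibp (sleZ_rpow_contDiff hΩo hΩb hwC hw0 hl (by linarith))
      (sleZ_rpow_hcs hΩo hΩb hwC.continuous hw0 hl (by linarith)) hwC, hE, ← integral_const_mul]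
    congr 1
    refine integral_congr_ae (Filter.Eventually.of_forall fun x => ?_)
    simp only
    rw [sleZ_rpow_gradient hΩo hΩb hwC hw0 hl (by linarith), inner_smul_left,
      real_inner_self_eq_norm_sq]
    rw [show s - 1 - 1 = s - 2 by ring]
    simp only [conj_trivial, hz]
    ring
  have id2 : ∫ x, z x ^ s * (v2 x * lapl v2 x)
      = - (s * (∫ x, z x ^ (s - 1) * (v2 x * inner ℝ (gradient w x) (gradient v2 x))) + D) := by
    have hzC := sleZ_rpow_contDiff hΩo hΩb hwC hw0 hl (m := s) (by linarith)
    have hv21 : ContDiff ℝ 1 v2 := hv2.of_le (by norm_num)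
    have := sle_ibp (a := fun x => z x ^ s * v2 x) (hzC.mul hv21)
      ((sleZ_rpow_hcs hΩo hΩb hwC.continuous hw0 hl (by linarith)).mul_right) hv2
    simp only [mul_assoc] at this
    rw [this, hD, ← integral_const_mul, ← integral_add (iX.const_mul s) iD]
    congr 1
    refine integral_congr_ae (Filter.Eventually.of_forall fun x => ?_)
    have hgr : gradient (fun x => z x ^ s * v2 x) x
        = z x ^ s • gradient v2 x + v2 x • ((s * z x ^ (s - 1)) • gradient w x) := by
      rw [← sleZ_rpow_gradient hΩo hΩb hwC hw0 hl (by linarith)]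
      simp only [sle_gradient_eq]
      rw [fderiv_fun_mul (hzC.differentiable (by norm_num) x)
        (hv21.differentiable (by norm_num) x)]
      simp [hz]
    simp only
    rw [hgr, inner_add_left, inner_smul_left, inner_smul_left, inner_smul_left,
      real_inner_self_eq_norm_sq]
    simp only [conj_trivial]
    ring
  -- pointwise bound 1
  have pw1 : ∀ x, - (z x ^ (s - 1) * lapl w x) + lam * l * z x ^ (s - 1)
      ≤ g x * z x ^ (s - 1) + (1 / 2) * (z x ^ (s - 2) * ‖gradient w x‖ ^ 2)
        + δ ^ 2 * (z x ^ s * ‖gradient v2 x‖ ^ 2) + Cδ ^ 2 * z x ^ s := by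
    intro x
    rw [hp1, hp2]
    have hβ : 0 ≤ z x ^ (s - 2) := Real.rpow_nonneg (hz0 x) _
    rcases eq_or_lt_of_le (hz0 x) with h0 | h0
    · rw [← h0, Real.zero_rpow (by linarith)]; simp
    have hxΩ : x ∈ Ω := by
      by_contra hc
      have : z x = 0 := sleZ_of_notMem w l hc
      linarith
    have hzx : z x = w x - l := by
      have h1 : z x = max (w x - l) 0 := sleZ_of_mem w l hxΩ
      rcases max_choice (w x - l) 0 with h2 | h2 <;> rw [h2] at h1
      · exact h1
      · linarith
    have e1 := hs1.2.2 x hxΩ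
    have e2 := hs2.2.2 x hxΩ
    have e3 : lapl w x = lapl v1 x - lapl v2 x := sle_lapl_sub hv1 hv2 x
    have e4 : gradient w x = gradient v1 x - gradient v2 x :=
      sle_gradient_sub (hv1.differentiable (by norm_num) x) (hv2.differentiable (by norm_num) x)
    have e5 := hconv (H x) (hHc x hxΩ) (fun p => ⟨by
      have h1 := (hH x hxΩ p).1
      have h2 : 0 ≤ CH⁻¹ * ‖p‖ ^ γ := by positivity
      linarith, (hH x hxΩ p).2⟩) (gradient v2 x) (gradient v1 x)
    rw [← e4] at e5
    have e6 := (abs_le.mp (hg x hxΩ)).2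
    set n := ‖gradient w x‖
    set m := ‖gradient v2 x‖
    have e7 : - lapl w x + lam * l ≤ g x + (δ * m + Cδ) * n := by
      have h1 : w x = v1 x - v2 x := rfl
      have h2 : lam * l ≤ lam * w x := by
        apply mul_le_mul_of_nonneg_left _ hlam.le; linarith
      rw [h1] at h2
      rw [e3]
      linarith
    have e8 : z x * (- lapl w x + lam * l)
        ≤ g x * z x + (1 / 2) * n ^ 2 + δ ^ 2 * (z x ^ 2 * m ^ 2) + Cδ ^ 2 * z x ^ 2 := by
      have h1 := mul_le_mul_of_nonneg_left e7 h0.le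
      have h2 : z x * ((δ * m + Cδ) * n) ≤ (1 / 2) * n ^ 2 + (1 / 2) * (z x * (δ * m + Cδ)) ^ 2 := by
        exact sle_aux1 _ _ _
      have h3 : (1 / 2) * (z x * (δ * m + Cδ)) ^ 2
          ≤ δ ^ 2 * (z x ^ 2 * m ^ 2) + Cδ ^ 2 * z x ^ 2 := by
        exact sle_aux2 _ _ _ _
      linarith
    have e9 := mul_le_mul_of_nonneg_left e8 hβ
    linarith
  have in1 : (s - 1) * E + lam * l * R ≤ GR + (1 / 2) * E + δ ^ 2 * D + Cδ ^ 2 * Q := by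
    have hmono := integral_mono (iRl.neg.add (iR.const_mul (lam * l)))
      (((hgi.add (iE.const_mul (1 / 2))).add (iD.const_mul (δ ^ 2))).add (iQ.const_mul (Cδ ^ 2)))
      (fun x => pw1 x)
    rw [integral_add' iRl.neg (iR.const_mul (lam * l)),
      integral_add' ((hgi.add (iE.const_mul (1 / 2))).add (iD.const_mul (δ ^ 2)))
        (iQ.const_mul (Cδ ^ 2)),
      integral_add' (hgi.add (iE.const_mul (1 / 2))) (iD.const_mul (δ ^ 2)),
      integral_add' hgi (iE.const_mul (1 / 2)), integral_neg',
      integral_const_mul, integral_const_mul, integral_const_mul, integral_const_mul, id1] at hmono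
    linarith
  -- pointwise bound 2
  have pw2 : ∀ x, - (z x ^ s * (v2 x * lapl v2 x))
        - s * (z x ^ (s - 1) * (v2 x * inner ℝ (gradient w x) (gradient v2 x)))
      ≤ (1 / 2) * (z x ^ s * ‖gradient v2 x‖ ^ 2)
        + s ^ 2 * M0 ^ 2 * (z x ^ (s - 2) * ‖gradient w x‖ ^ 2) + C' * z x ^ s := by
    intro x
    rw [hp1, hp2]
    have hβ : 0 ≤ z x ^ (s - 2) := Real.rpow_nonneg (hz0 x) _
    by_cases hxΩ : x ∈ Ω
    swap
    · have : z x = 0 := sleZ_of_notMem w l hxΩ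
      rw [this, Real.zero_rpow (by linarith)]; simp
    have e2 := hs2.2.2 x hxΩ
    have hb := hv2b x hxΩ
    have hin := abs_real_inner_le_norm (gradient w x) (gradient v2 x)
    set n := ‖gradient w x‖
    set m := ‖gradient v2 x‖
    have hm : 0 ≤ m := norm_nonneg _
    have hn : 0 ≤ n := norm_nonneg _
    have hHb := hH x hxΩ (gradient v2 x)
    have hHb1 : 0 ≤ CH⁻¹ * m ^ γ := by positivity
    have hmγ : 0 ≤ m ^ γ := by positivity
    have hlap : |lapl v2 x| ≤ lam * M0 + M + CH * (m ^ γ + 1) := by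
      have h1 := abs_le.mp hb
      have h2 := abs_le.mp (hf2 x hxΩ)
      have h3 : lapl v2 x = lam * v2 x + H x (gradient v2 x) - f2 x := by linarith
      have h4 : lam * v2 x ≤ lam * M0 := mul_le_mul_of_nonneg_left h1.2 hlam.le
      have h5 : lam * (- M0) ≤ lam * v2 x := mul_le_mul_of_nonneg_left h1.1 hlam.le
      have h6 : 0 ≤ CH * m ^ γ := by positivity
      rw [abs_le, h3]
      constructor <;> linarith [hHb.1, hHb.2]
    have hY' : m ^ γ ≤ 1 / (4 * M0 * CH) * m ^ 2 + C0 := by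
      have := hY m hm
      rwa [Real.rpow_two] at this
    have h7 : |v2 x * lapl v2 x| ≤ (1 / 4) * m ^ 2 + C' := by
      rw [abs_mul]
      calc |v2 x| * |lapl v2 x| ≤ M0 * (lam * M0 + M + CH * (m ^ γ + 1)) := by gcongr
        _ ≤ M0 * (lam * M0 + M + CH * ((1 / (4 * M0 * CH) * m ^ 2 + C0) + 1)) := by gcongr
        _ = (1 / 4) * m ^ 2 + C' := by rw [hC']; field_simp; ring
    have h8 : |s * (v2 x * inner ℝ (gradient w x) (gradient v2 x))| ≤ s * (M0 * (n * m)) := by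
      rw [abs_mul, abs_mul, abs_of_pos hs0]
      gcongr
    have h9 : z x ^ 2 * (-(v2 x * lapl v2 x)) ≤ z x ^ 2 * ((1 / 4) * m ^ 2 + C') :=
      mul_le_mul_of_nonneg_left ((neg_le_abs _).trans h7) (by positivity)
    have h10 : z x * (-(s * (v2 x * inner ℝ (gradient w x) (gradient v2 x))))
        ≤ z x * (s * (M0 * (n * m))) :=
      mul_le_mul_of_nonneg_left ((neg_le_abs _).trans h8) (hz0 x)
    have h11 : z x * (s * (M0 * (n * m))) ≤ (1 / 4) * (z x ^ 2 * m ^ 2) + s ^ 2 * M0 ^ 2 * n ^ 2 := by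
      exact sle_aux3 _ _ _ _ _
    have h12 : z x ^ 2 * (-(v2 x * lapl v2 x))
          + z x * (-(s * (v2 x * inner ℝ (gradient w x) (gradient v2 x))))
        ≤ (1 / 2) * (z x ^ 2 * m ^ 2) + s ^ 2 * M0 ^ 2 * n ^ 2 + C' * z x ^ 2 := by linarith
    have h13 := mul_le_mul_of_nonneg_left h12 hβ
    linarith
  have in2 : D ≤ (1 / 2) * D + s ^ 2 * M0 ^ 2 * E + C' * Q := by
    have hmono := integral_mono (iQl.neg.sub (iX.const_mul s))
      (((iD.const_mul (1 / 2)).add (iE.const_mul (s ^ 2 * M0 ^ 2))).add (iQ.const_mul C'))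
      (fun x => pw2 x)
    rw [integral_sub' iQl.neg (iX.const_mul s),
      integral_add' ((iD.const_mul (1 / 2)).add (iE.const_mul (s ^ 2 * M0 ^ 2))) (iQ.const_mul C'),
      integral_add' (iD.const_mul (1 / 2)) (iE.const_mul (s ^ 2 * M0 ^ 2)), integral_neg',
      integral_const_mul, integral_const_mul, integral_const_mul, integral_const_mul, id2] at hmono
    linarith
  have hE0 : 0 ≤ E := integral_nonneg fun x =>
    mul_nonneg (Real.rpow_nonneg (hz0 x) _) (sq_nonneg _)
  have in3 : δ ^ 2 * D ≤ (1 / 8) * E + 2 * C' * δ ^ 2 * Q := by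
    have h1 : D ≤ 2 * s ^ 2 * M0 ^ 2 * E + 2 * C' * Q := by linarith
    have h2 := mul_le_mul_of_nonneg_left h1 (sq_nonneg δ)
    have h3 : δ ^ 2 * (2 * s ^ 2 * M0 ^ 2 * E + 2 * C' * Q)
        = (1 / 8) * E + 2 * C' * δ ^ 2 * Q := by
      have : δ ^ 2 * (2 * s ^ 2 * M0 ^ 2) = 1 / 8 := by
        rw [hδ]; field_simp; norm_num
      linear_combination E * this
    linarith
  have in4 : 0 ≤ (s - 2) * E := mul_nonneg (by linarith) hE0
  linarith

set_option maxHeartbeats 1600000 in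
/-- One step of the level set argument. -/
lemma sle_step {d : ℕ} (hd : 2 < d) {γ lam CH M s p q : ℝ} (hγ1 : 1 < γ) (hγ2 : γ < 2)
    (hlam : 0 < lam) (hCH : 0 < CH) (hM : 0 ≤ M) (hs : 2 < s)
    (hp : s * (d:ℝ) / (d - 2) = p) (hq : q.HolderConjugate (p / (s - 1))) :
    ∃ κ ε C4 : ℝ, 0 < κ ∧ 0 < ε ∧ 0 < C4 ∧
      ∀ (Ω : Set (Euc d)) (H : Euc d → Euc d → ℝ) (f1 f2 v1 v2 g : Euc d → ℝ)
      (l G : ℝ), IsOpen Ω → Bornology.IsBounded Ω → GrowthH Ω CH γ H →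
      (∀ x ∈ Ω, ConvexOn ℝ Set.univ (H x)) → (∀ x ∈ Ω, |f2 x| ≤ M) →
      ContDiff ℝ 2 v1 → ContDiff ℝ 2 v2 →
      IsClassicalSol Ω lam H f1 v1 → IsClassicalSol Ω lam H f2 v2 →
      (∀ x ∈ Ω, |f1 x - f2 x| ≤ g x) → 0 < l →
      (∀ x, 0 ≤ g x) → MemLp g (ENNReal.ofReal q) volume → 0 ≤ G → ∫ x, g x ^ q ≤ G ^ q →
      volume.real {x | κ * l < sleZ Ω (fun x => v1 x - v2 x) l x} ≤ ε →
      ∫ x, sleZ Ω (fun x => v1 x - v2 x) l x ^ p ≤ (C4 * G) ^ p := by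
  obtain ⟨C3, hC3, hen⟩ := sle_energy (d := d) hγ1 hγ2 hlam hCH hM hs
  obtain ⟨S, hS, hsob⟩ := sle_sobolev d hd
  have hd' : (2:ℝ) < d := by exact_mod_cast hd
  have hd2 : (d:ℝ) - 2 ≠ 0 := by linarith
  have hs0 : 0 < s := by linarith
  have hp0 : 0 < p := by rw [← hp]; exact div_pos (by positivity) (by linarith)
  have hsp : s / p = ((d:ℝ) - 2) / d := by rw [← hp]; field_simp
  have hsp1 : s / p < 1 := by rw [hsp, div_lt_one (by linarith)]; linarith
  have hθ : 0 < 1 - s / p := by linarith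
  set K : ℝ := S * s ^ 2 with hK
  have hK0 : 0 < K := by positivity
  refine ⟨lam / C3, (1 / (2 * K * C3)) ^ (1 / (1 - s / p)), 2 * K, by positivity, by positivity,
    by positivity, ?_⟩
  intro Ω H f1 f2 v1 v2 g l G hΩo hΩb hH hHc hf2 hv1 hv2 hs1 hs2 hg hl hg0 hgm hG hgG hA
  set w : Euc d → ℝ := fun x => v1 x - v2 x with hw
  have hwC : ContDiff ℝ 2 w := hv1.sub hv2
  have hw0 : ∀ x ∈ frontier Ω, w x = 0 := fun x hx => by
    simp only [hw]; rw [hs1.2.1 x hx, hs2.2.1 x hx, sub_zero]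
  set z : Euc d → ℝ := sleZ Ω w l with hz
  have hz0 : ∀ x, 0 ≤ z x := sleZ_nonneg Ω w l
  have hzc : Continuous z := sleZ_continuous hΩo hΩb hwC.continuous hw0 hl
  have hpc : ∀ {m : ℝ}, 0 < m → Continuous (fun x => z x ^ m) := fun hm =>
    sleZ_rpow_cont hΩo hΩb hwC.continuous hw0 hl hm
  have hps : ∀ {m : ℝ}, 0 < m → HasCompactSupport (fun x => z x ^ m) := fun hm =>
    sleZ_rpow_hcs hΩo hΩb hwC.continuous hw0 hl hm
  set P := ∫ x, z x ^ p with hP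
  have hP0 : 0 ≤ P := integral_nonneg fun x => Real.rpow_nonneg (hz0 x) _
  set A : Set (Euc d) := {x | lam / C3 * l < z x} with hAdef
  have hAo : IsOpen A := isOpen_lt continuous_const hzc
  have hAΩ : A ⊆ Ω := by
    intro x hx
    by_contra hc
    have h1 : z x = 0 := sleZ_of_notMem w l hc
    have h2 : lam / C3 * l < z x := hx
    have h3 : 0 < lam / C3 * l := by positivity
    linarith
  have hAfin : volume A ≠ ⊤ := ((measure_mono hAΩ).trans_lt hΩb.measure_lt_top).ne
  have hm1 : MemLp (fun x => z x ^ (s - 1)) (ENNReal.ofReal (p / (s - 1))) volume :=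
    (hpc (by linarith)).memLp_of_hasCompactSupport (hps (by linarith))
  -- Hölder for the source term
  have hHold1 : ∫ x, g x * z x ^ (s - 1) ≤ G * P ^ ((s - 1) / p) := by
    have h := integral_mul_le_Lp_mul_Lq_of_nonneg hq (μ := (volume : Measure (Euc d)))
      (f := g) (g := fun x => z x ^ (s - 1)) (Filter.Eventually.of_forall hg0)
      (Filter.Eventually.of_forall fun x => Real.rpow_nonneg (hz0 x) _) hgm hm1
    have e1 : ∀ x, (z x ^ (s - 1)) ^ (p / (s - 1)) = z x ^ p := fun x => by
      rw [← Real.rpow_mul (hz0 x)]; congr 1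
      have : s - 1 ≠ 0 := by linarith
      field_simp
    simp only [e1] at h
    rw [← hP, one_div_div] at h
    refine h.trans ?_
    gcongr
    calc (∫ x, g x ^ q) ^ (1 / q) ≤ (G ^ q) ^ (1 / q) := by
          apply Real.rpow_le_rpow _ hgG (by have := hq.pos; positivity)
          exact integral_nonneg fun x => Real.rpow_nonneg (hg0 x) _
      _ = G := by
          rw [← Real.rpow_mul hG, mul_one_div_cancel hq.ne_zero, Real.rpow_one]
  have hgi : Integrable (fun x => g x * z x ^ (s - 1)) := by
    haveI : ENNReal.HolderConjugate (ENNReal.ofReal q) (ENNReal.ofReal (p / (s - 1))) :=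
      hq.ennrealOfReal
    exact hgm.integrable_mul hm1
  have hconj2 : (p / (p - s)).HolderConjugate (p / s) := by
    rw [Real.holderConjugate_iff]
    have h1 : s < p := by rwa [div_lt_one hp0] at hsp1
    constructor
    · rw [lt_div_iff₀ (by linarith)]; linarith
    · rw [inv_div, inv_div]; field_simp; ring
  have hind : MemLp (A.indicator (fun _ => (1:ℝ))) (ENNReal.ofReal (p / (p - s))) volume :=
    memLp_indicator_const _ hAo.measurableSet 1 (Or.inr hAfin)
  have hm2 : MemLp (fun x => z x ^ s) (ENNReal.ofReal (p / s)) volume :=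
    (hpc (by linarith)).memLp_of_hasCompactSupport (hps (by linarith))
  have hHold2 : ∫ x, A.indicator (fun _ => (1:ℝ)) x * z x ^ s
      ≤ (volume.real A) ^ (1 - s / p) * P ^ (s / p) := by
    have h := integral_mul_le_Lp_mul_Lq_of_nonneg hconj2 (μ := (volume : Measure (Euc d)))
      (f := A.indicator (fun _ => (1:ℝ))) (g := fun x => z x ^ s)
      (Filter.Eventually.of_forall fun x => Set.indicator_nonneg (fun _ _ => zero_le_one) x)
      (Filter.Eventually.of_forall fun x => Real.rpow_nonneg (hz0 x) _) hind hm2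
    have e1 : ∀ x, (z x ^ s) ^ (p / s) = z x ^ p := fun x => by
      rw [← Real.rpow_mul (hz0 x)]; congr 1
      field_simp
    have e2 : ∀ x, A.indicator (fun _ => (1:ℝ)) x ^ (p / (p - s))
        = A.indicator (fun _ => (1:ℝ)) x := fun x => by
      by_cases hx : x ∈ A
      · simp [hx]
      · simp only [hx, not_false_eq_true, Set.indicator_of_notMem]
        exact Real.zero_rpow hconj2.ne_zero
    simp only [e1, e2] at h
    rw [← hP, one_div_div, one_div_div, integral_indicator_const _ hAo.measurableSet] at h
    rw [show (p - s) / p = 1 - s / p by field_simp] at h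
    simpa using h
  have hQAi : Integrable (fun x => A.indicator (fun _ => (1:ℝ)) x * z x ^ s) := by
    haveI : ENNReal.HolderConjugate (ENNReal.ofReal (p / (p - s))) (ENNReal.ofReal (p / s)) :=
      hconj2.ennrealOfReal
    exact hind.integrable_mul hm2
  have hRi : Integrable (fun x => z x ^ (s - 1)) :=
    (hpc (by linarith)).integrable_of_hasCompactSupport (hps (by linarith))
  have hQi : Integrable (fun x => z x ^ s) :=
    (hpc (by linarith)).integrable_of_hasCompactSupport (hps (by linarith))
  have hen' := hen Ω H f1 f2 v1 v2 g l hΩo hΩb hH hHc hf2 hv1 hv2 hs1 hs2 hg hl hgi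
  have hlow : C3 * ∫ x, z x ^ s ≤ lam * l * (∫ x, z x ^ (s - 1))
      + C3 * ∫ x, A.indicator (fun _ => (1:ℝ)) x * z x ^ s := by
    rw [← integral_const_mul, ← integral_const_mul, ← integral_const_mul,
      ← integral_add (hRi.const_mul _) (hQAi.const_mul _)]
    refine integral_mono (hQi.const_mul _) ((hRi.const_mul _).add (hQAi.const_mul _)) fun x => ?_
    have hr : 0 ≤ z x ^ (s - 1) := Real.rpow_nonneg (hz0 x) _
    by_cases hx : x ∈ A
    · simp only [hx, Set.indicator_of_mem, one_mul]
      have : 0 ≤ lam * l * z x ^ (s - 1) := by positivity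
      linarith
    · simp only [hx, not_false_eq_true, Set.indicator_of_notMem, zero_mul, mul_zero, add_zero]
      have h1 : z x ≤ lam / C3 * l := not_lt.mp hx
      have h2 : z x ^ s = z x ^ (s - 1) * z x := by
        rw [← Real.rpow_add_one' (hz0 x) (by linarith)]; congr 1; ring
      have h3 : C3 * z x ≤ lam * l := by
        calc C3 * z x ≤ C3 * (lam / C3 * l) := by gcongr
          _ = lam * l := by field_simp
      have := mul_le_mul_of_nonneg_right h3 hr
      rw [h2]; linarith
  have hsob' : P ^ (s / p) ≤ S * ((s ^ 2 / 4) * ∫ x, z x ^ (s - 2) * ‖gradient w x‖ ^ 2) := by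
    have h := hsob (fun x => z x ^ (s / 2)) (sleZ_rpow_contDiff hΩo hΩb hwC hw0 hl (by linarith))
      (hps (by linarith))
    have e1 : ∀ x, |z x ^ (s / 2)| ^ (2 * (d:ℝ) / (d - 2)) = z x ^ p := fun x => by
      rw [abs_of_nonneg (Real.rpow_nonneg (hz0 x) _), ← Real.rpow_mul (hz0 x), ← hp]
      congr 1; field_simp
    have e2 : ∀ x, ‖fderiv ℝ (fun x => z x ^ (s / 2)) x‖ ^ 2
        = (s ^ 2 / 4) * (z x ^ (s - 2) * ‖gradient w x‖ ^ 2) := fun x => by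
      rw [sleZ_rpow_fderiv hΩo hΩb hwC hw0 hl (by linarith), norm_smul, sle_norm_gradient,
        Real.norm_of_nonneg (mul_nonneg (by linarith) (Real.rpow_nonneg (hz0 x) _)), mul_pow,
        mul_pow]
      have : (sleZ Ω w l x ^ (s / 2 - 1)) ^ 2 = z x ^ (s - 2) := by
        rw [← Real.rpow_natCast, ← Real.rpow_mul (hz0 x)]
        congr 1; push_cast; ring
      rw [this]; ring
    simp only [e1, e2] at h
    rw [← hP, ← hsp, integral_const_mul] at h
    exact h
  set E := ∫ x, z x ^ (s - 2) * ‖gradient w x‖ ^ 2 with hE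
  set QA := ∫ x, A.indicator (fun _ => (1:ℝ)) x * z x ^ s with hQA
  have h1 : P ^ (s / p) ≤ K * (G * P ^ ((s - 1) / p)
      + C3 * ((volume.real A) ^ (1 - s / p) * P ^ (s / p))) := by
    have h2 : (1 / 4) * E ≤ G * P ^ ((s - 1) / p)
      + C3 * ((volume.real A) ^ (1 - s / p) * P ^ (s / p)) := by
      have := mul_le_mul_of_nonneg_left hHold2 hC3.le
      linarith
    calc P ^ (s / p) ≤ K * ((1 / 4) * E) := by
          refine hsob'.trans (le_of_eq ?_); rw [hK]; ring
      _ ≤ _ := by gcongr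
  have h2 : (volume.real A) ^ (1 - s / p) ≤ 1 / (2 * K * C3) := by
    calc (volume.real A) ^ (1 - s / p)
        ≤ ((1 / (2 * K * C3)) ^ (1 / (1 - s / p))) ^ (1 - s / p) :=
          Real.rpow_le_rpow measureReal_nonneg hA hθ.le
      _ = _ := by
          rw [← Real.rpow_mul (by positivity), one_div_mul_cancel hθ.ne', Real.rpow_one]
  have hPs : 0 ≤ P ^ (s / p) := Real.rpow_nonneg hP0 _
  have h3 : P ^ (s / p) ≤ 2 * K * G * P ^ ((s - 1) / p) := by
    have h4 : K * (C3 * ((volume.real A) ^ (1 - s / p) * P ^ (s / p))) ≤ (1 / 2) * P ^ (s / p) := by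
      calc K * (C3 * ((volume.real A) ^ (1 - s / p) * P ^ (s / p)))
          ≤ K * (C3 * (1 / (2 * K * C3) * P ^ (s / p))) := by gcongr
        _ = (1 / 2) * P ^ (s / p) := by field_simp
    linarith
  rcases eq_or_lt_of_le hP0 with h0 | h0
  · rw [← h0]; positivity
  have h5 : P ^ (s / p) = P ^ (1 / p) * P ^ ((s - 1) / p) := by
    rw [← Real.rpow_add h0]; congr 1; ring
  have h6 : P ^ (1 / p) ≤ 2 * K * G := by
    rw [h5] at h3
    exact le_of_mul_le_mul_right h3 (Real.rpow_pos_of_pos h0 _)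
  calc P = (P ^ (1 / p)) ^ p := by
        rw [← Real.rpow_mul hP0, one_div_mul_cancel hp0.ne', Real.rpow_one]
    _ ≤ (2 * K * G) ^ p := Real.rpow_le_rpow (Real.rpow_nonneg hP0 _) h6 hp0.le

lemma sle_descent {Pr : ℝ → Prop} {T ρ : ℝ} (hT : 0 < T) (hρ : 1 < ρ)
    (hB : ∃ B, ∀ t, B ≤ t → Pr t) (hstep : ∀ t, T ≤ t → Pr (ρ * t) → Pr t) : Pr T := by
  obtain ⟨B, hB⟩ := hB
  obtain ⟨n, hn⟩ := pow_unbounded_of_one_lt (B / T) hρ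
  have key : ∀ n : ℕ, Pr (ρ ^ n * T) → Pr T := by
    intro n
    induction n with
    | zero => intro h; simpa using h
    | succ k ih =>
      intro h
      apply ih
      apply hstep
      · exact le_mul_of_one_le_left hT.le (one_le_pow₀ hρ.le)
      · rwa [pow_succ', mul_assoc] at h
  apply key n
  apply hB
  rw [div_lt_iff₀ hT] at hn
  exact hn.le

lemma sleZ_superlevel {d : ℕ} (Ω : Set (Euc d)) (w : Euc d → ℝ) {l a : ℝ} (hl : 0 < l)
    (ha : 0 < a) : {x | a * l < sleZ Ω w l x} = {x | x ∈ Ω ∧ (1 + a) * l < w x} := by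
  have hal : 0 < a * l := mul_pos ha hl
  ext x
  simp only [Set.mem_ofPred_eq]
  by_cases hx : x ∈ Ω
  · rw [sleZ_of_mem w l hx, lt_max_iff]
    constructor
    · rintro (h | h)
      · exact ⟨hx, by linarith⟩
      · linarith
    · rintro ⟨_, h⟩; left; linarith
  · rw [sleZ_of_notMem w l hx]
    constructor
    · intro h; linarith
    · rintro ⟨h, _⟩; exact absurd h hx

lemma sle_level {d : ℕ} {Ω : Set (Euc d)} (hΩo : IsOpen Ω) (hΩb : Bornology.IsBounded Ω)
    {w : Euc d → ℝ} (hw : Continuous w) (hw0 : ∀ x ∈ frontier Ω, w x = 0)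
    {κ ε A p : ℝ} (hκ : 0 < κ) (hε : 0 < ε) (hA : 0 < A) (hp : 0 < p)
    (hstep : ∀ l, 0 < l → volume.real {x | κ * l < sleZ Ω w l x} ≤ ε →
      ∫ x, sleZ Ω w l x ^ p ≤ A ^ p) :
    ∫ x, sleZ Ω w (2 * A / (κ * ε ^ (1 / p))) x ^ p ≤ A ^ p := by
  set l0 : ℝ := 2 * A / (κ * ε ^ (1 / p)) with hl0
  have hεp : 0 < ε ^ (1 / p) := Real.rpow_pos_of_pos hε _
  have hl0pos : 0 < l0 := by positivity
  have hfin : ∀ t : ℝ, volume {x | x ∈ Ω ∧ t < w x} ≠ ⊤ := fun t =>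
    ((measure_mono (fun x hx => hx.1)).trans_lt hΩb.measure_lt_top).ne
  have hmono : ∀ s t : ℝ, s ≤ t → volume.real {x | x ∈ Ω ∧ t < w x} ≤
      volume.real {x | x ∈ Ω ∧ s < w x} := fun s t hst =>
    measureReal_mono (fun x hx => ⟨hx.1, hst.trans_lt hx.2⟩) (hfin s)
  have main : volume.real {x | x ∈ Ω ∧ (1 + κ / 2) * l0 < w x} ≤ ε := by
    refine sle_descent (Pr := fun t => volume.real {x | x ∈ Ω ∧ t < w x} ≤ ε)
      (T := (1 + κ / 2) * l0) (ρ := (1 + κ) / (1 + κ / 2)) (by positivity)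
      (by rw [lt_div_iff₀ (by positivity)]; linarith) ?_ ?_
    · obtain ⟨B, hB⟩ := (hΩb.isCompact_closure.image hw).bddAbove
      refine ⟨B, fun t ht => ?_⟩
      have : {x | x ∈ Ω ∧ t < w x} = ∅ := by
        ext x
        simp only [Set.mem_ofPred_eq, Set.mem_empty_iff_false, iff_false, not_and, not_lt]
        intro hx
        exact (hB ⟨x, subset_closure hx, rfl⟩).trans ht
      simp only [this, measureReal_empty]
      exact hε.le
    · intro t ht hP
      set l : ℝ := t / (1 + κ / 2) with hl
      have htl : t = (1 + κ / 2) * l := by rw [hl]; field_simp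
      have hll : l0 ≤ l := by rw [hl, le_div_iff₀ (by positivity)]; linarith
      have hlpos : 0 < l := hl0pos.trans_le hll
      have e1 : (1 + κ) / (1 + κ / 2) * t = (1 + κ) * l := by rw [hl]; ring
      rw [e1, ← sleZ_superlevel Ω w hlpos hκ] at hP
      have hI := hstep l hlpos hP
      have hintg : Integrable (fun x => sleZ Ω w l x ^ p) :=
        (sleZ_rpow_cont hΩo hΩb hw hw0 hlpos hp).integrable_of_hasCompactSupport
          (sleZ_rpow_hcs hΩo hΩb hw hw0 hlpos hp)
      have hch := mul_meas_ge_le_integral_of_nonneg (μ := volume)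
        (f := fun x => sleZ Ω w l x ^ p)
        (Filter.Eventually.of_forall fun x => Real.rpow_nonneg (sleZ_nonneg Ω w l x) p) hintg
        ((κ / 2 * l) ^ p)
      have hsub : volume.real {x | x ∈ Ω ∧ t < w x} ≤
          volume.real {x | (κ / 2 * l) ^ p ≤ sleZ Ω w l x ^ p} := by
        rw [htl, ← sleZ_superlevel Ω w hlpos (half_pos hκ)]
        refine measureReal_mono (fun x hx => ?_)
          (hintg.measure_ge_lt_top (by positivity)).ne
        exact Real.rpow_le_rpow (by positivity) (le_of_lt hx) hp.le
      have hb : A ^ p ≤ (κ / 2 * l) ^ p * ε := by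
        have : A ≤ κ / 2 * l * ε ^ (1 / p) := by
          have h2 : A = κ / 2 * l0 * ε ^ (1 / p) := by rw [hl0]; field_simp
          rw [h2]; gcongr
        calc A ^ p ≤ (κ / 2 * l * ε ^ (1 / p)) ^ p := Real.rpow_le_rpow hA.le this hp.le
          _ = _ := by
            rw [Real.mul_rpow (by positivity) hεp.le, ← Real.rpow_mul hε.le,
              one_div_mul_cancel hp.ne', Real.rpow_one]
      have hpos : 0 < (κ / 2 * l) ^ p := by positivity
      refine hsub.trans (le_of_mul_le_mul_left ?_ hpos)
      exact hch.trans (hI.trans hb)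
  apply hstep l0 hl0pos
  rw [sleZ_superlevel Ω w hl0pos hκ]
  exact (hmono _ _ (by gcongr; linarith)).trans main

lemma sle_rpow_three {a b c p : ℝ} (ha : 0 ≤ a) (hb : 0 ≤ b) (hc : 0 ≤ c) (hp : 0 ≤ p) :
    (a + b + c) ^ p ≤ 3 ^ p * (a ^ p + b ^ p + c ^ p) := by
  have h1 : a + b + c ≤ 3 * max a (max b c) := by
    have := le_max_left a (max b c)
    have := le_max_right a (max b c)
    have := le_max_left b c
    have := le_max_right b c
    linarith
  have h2 : (max a (max b c)) ^ p ≤ a ^ p + b ^ p + c ^ p := by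
    have := Real.rpow_nonneg ha p
    have := Real.rpow_nonneg hb p
    have := Real.rpow_nonneg hc p
    rcases max_choice a (max b c) with h | h
    · rw [h]; linarith
    · rw [h]
      rcases max_choice b c with h | h <;> rw [h] <;> linarith
  calc (a + b + c) ^ p ≤ (3 * max a (max b c)) ^ p :=
        Real.rpow_le_rpow (by positivity) h1 hp
    _ = 3 ^ p * (max a (max b c)) ^ p := Real.mul_rpow (by norm_num) (le_max_of_le_left ha)
    _ ≤ _ := by gcongr

/-- Two-sided level estimate gives the `L^p` bound. -/
lemma sle_combine {d : ℕ} {Ω : Set (Euc d)} (hΩo : IsOpen Ω) (hΩb : Bornology.IsBounded Ω)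
    {w1 w2 : Euc d → ℝ} (hw : Continuous w1) (hw0 : ∀ x ∈ frontier Ω, w1 x = 0)
    (h12 : ∀ x, w2 x = - w1 x)
    {l A p : ℝ} (hl : 0 < l) (hp : 0 < p)
    (h1 : ∫ x, sleZ Ω w1 l x ^ p ≤ A) (h2 : ∫ x, sleZ Ω w2 l x ^ p ≤ A) :
    ∫ x in Ω, |w1 x| ^ p ≤ 3 ^ p * (l ^ p * volume.real Ω + 2 * A) := by
  have hw2 : Continuous w2 := by
    have : w2 = fun x => - w1 x := funext h12
    rw [this]; exact hw.neg
  have hw20 : ∀ x ∈ frontier Ω, w2 x = 0 := fun x hx => by rw [h12, hw0 x hx, neg_zero]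
  have i1 : Integrable (fun x => sleZ Ω w1 l x ^ p) :=
    (sleZ_rpow_cont hΩo hΩb hw hw0 hl hp).integrable_of_hasCompactSupport
      (sleZ_rpow_hcs hΩo hΩb hw hw0 hl hp)
  have i2 : Integrable (fun x => sleZ Ω w2 l x ^ p) :=
    (sleZ_rpow_cont hΩo hΩb hw2 hw20 hl hp).integrable_of_hasCompactSupport
      (sleZ_rpow_hcs hΩo hΩb hw2 hw20 hl hp)
  have hvol : volume Ω ≠ ⊤ := hΩb.measure_lt_top.ne
  have i0 : IntegrableOn (fun _ : Euc d => l ^ p) Ω := integrableOn_const hvol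
  have iw : IntegrableOn (fun x => |w1 x| ^ p) Ω :=
    ((hw.abs.rpow_const fun _ => Or.inr hp.le).continuousOn.integrableOn_compact
      hΩb.isCompact_closure).mono_set subset_closure
  have n1 : ∀ x, 0 ≤ sleZ Ω w1 l x ^ p := fun x => Real.rpow_nonneg (sleZ_nonneg _ _ _ _) _
  have n2 : ∀ x, 0 ≤ sleZ Ω w2 l x ^ p := fun x => Real.rpow_nonneg (sleZ_nonneg _ _ _ _) _
  calc ∫ x in Ω, |w1 x| ^ p
      ≤ ∫ x in Ω, 3 ^ p * (l ^ p + sleZ Ω w1 l x ^ p + sleZ Ω w2 l x ^ p) := by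
        refine setIntegral_mono_on iw
          (((i0.add i1.integrableOn).add i2.integrableOn).const_mul _) hΩo.measurableSet ?_
        intro x hx
        refine le_trans ?_ (sle_rpow_three hl.le (sleZ_nonneg Ω w1 l x) (sleZ_nonneg Ω w2 l x) hp.le)
        refine Real.rpow_le_rpow (abs_nonneg _) ?_ hp.le
        rw [sleZ_of_mem w1 l hx, sleZ_of_mem w2 l hx, h12]
        have a1 := le_max_left (w1 x - l) 0
        have a2 := le_max_right (w1 x - l) 0
        have a3 := le_max_left (-w1 x - l) 0
        have a4 := le_max_right (-w1 x - l) 0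
        rw [abs_le]; constructor <;> linarith
    _ = 3 ^ p * (l ^ p * volume.real Ω + (∫ x in Ω, sleZ Ω w1 l x ^ p)
          + ∫ x in Ω, sleZ Ω w2 l x ^ p) := by
        have i01 : IntegrableOn (fun x => l ^ p + sleZ Ω w1 l x ^ p) Ω := i0.add i1.integrableOn
        rw [integral_const_mul, integral_add i01 i2.integrableOn,
          integral_add i0 i1.integrableOn, setIntegral_const, smul_eq_mul, mul_comm (l ^ p)]
    _ ≤ _ := by
        have j1 := setIntegral_le_integral (s := Ω) i1 (Filter.Eventually.of_forall n1)
        have j2 := setIntegral_le_integral (s := Ω) i2 (Filter.Eventually.of_forall n2)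
        have : 0 ≤ (3:ℝ) ^ p := by positivity
        refine mul_le_mul_of_nonneg_left ?_ this
        linarith

/-- The right-hand side of a problem with a classical solution is bounded. -/
lemma sle_rhs_bounded {d : ℕ} {Ω : Set (Euc d)} (hΩb : Bornology.IsBounded Ω)
    {lam CH γ : ℝ} (hCH : 0 < CH) (hγ : 0 < γ) {H : Euc d → Euc d → ℝ} {f u : Euc d → ℝ}
    (hH : GrowthH Ω CH γ H) (hu : IsClassicalSol Ω lam H f u) :
    ∃ M, 0 ≤ M ∧ ∀ x ∈ Ω, |f x| ≤ M := by
  obtain ⟨v, hv, hs, -⟩ := sle_ext_sol hΩb hu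
  have hcomp := hΩb.isCompact_closure
  have c1 : Continuous fun x => |lapl v x| + |lam * v x| + CH * (‖gradient v x‖ ^ γ + 1) := by
    have e1 := sle_lapl_continuous hv
    have e2 := sle_gradient_continuous (hv.of_le (by norm_num))
    have e3 := hv.continuous
    have e4 : Continuous fun x => ‖gradient v x‖ ^ γ :=
      e2.norm.rpow_const fun _ => Or.inr hγ.le
    exact (e1.abs.add (continuous_const.mul e3).abs).add
      (continuous_const.mul (e4.add continuous_const))
  obtain ⟨B, hB⟩ := (hcomp.image c1).bddAbove
  refine ⟨max B 0, le_max_right _ _, fun x hx => le_max_of_le_left ?_⟩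
  refine le_trans ?_ (hB ⟨x, subset_closure hx, rfl⟩)
  have hH1 := hH x hx (gradient v x)
  have hg : 0 ≤ ‖gradient v x‖ ^ γ := by positivity
  have hci : 0 ≤ CH⁻¹ * ‖gradient v x‖ ^ γ := by positivity
  have hcg : 0 ≤ CH * ‖gradient v x‖ ^ γ := by positivity
  have hHa : |H x (gradient v x)| ≤ CH * (‖gradient v x‖ ^ γ + 1) := by
    rw [abs_le]; constructor
    · linarith [hH1.1]
    · exact hH1.2
  rw [← hs.2.2 x hx]
  calc |-lapl v x + lam * v x + H x (gradient v x)|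
      ≤ |-lapl v x + lam * v x| + |H x (gradient v x)| := abs_add_le _ _
    _ ≤ |-lapl v x| + |lam * v x| + |H x (gradient v x)| := by
        gcongr; exact abs_add_le _ _
    _ ≤ _ := by rw [abs_neg]; exact add_le_add_right hHa _

lemma sle_trunc_abs {k s : ℝ} (hk : 0 < k) : |s - trunc k s| = max (|s| - k) 0 ∧
    |trunc k s| ≤ |s| := by
  unfold trunc
  rcases le_total s k with h1 | h1 <;> rcases le_total (-k) s with h2 | h2
  · rw [min_eq_left h1, max_eq_right h2, sub_self, abs_zero]
    exact ⟨(max_eq_right (by linarith [abs_le.2 ⟨h2, h1⟩])).symm, le_rfl⟩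
  · rw [min_eq_left h1, max_eq_left h2, abs_of_nonpos (show s ≤ 0 by linarith),
      abs_of_nonpos (show s - -k ≤ 0 by linarith), abs_of_nonpos (show -k ≤ 0 by linarith),
      max_eq_left (by linarith)]
    exact ⟨by ring, by linarith⟩
  · rw [min_eq_right h1, max_eq_right (by linarith), abs_of_nonneg (show 0 ≤ s by linarith),
      abs_of_nonneg (show 0 ≤ s - k by linarith), abs_of_nonneg hk.le, max_eq_left (by linarith)]
    exact ⟨rfl, h1⟩
  · linarith

lemma sle_g_memLp {d : ℕ} {Ω : Set (Euc d)} (hΩo : IsOpen Ω) (hΩb : Bornology.IsBounded Ω)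
    {f : Euc d → ℝ} {q k M : ℝ} (hq : 0 < q) (hk : 0 < k)
    (hf : IntegrableOn (fun x => |f x| ^ q) Ω) (hM : ∀ x ∈ Ω, |f x| ≤ M) :
    MemLp (Ω.indicator (fun x => |f x - trunc k (f x)|)) (ENNReal.ofReal q) volume := by
  rw [memLp_indicator_iff_restrict hΩo.measurableSet]
  have hfin : IsFiniteMeasure (volume.restrict Ω) := ⟨by simpa using hΩb.measure_lt_top⟩
  have hm : AEStronglyMeasurable (fun x => |f x - trunc k (f x)|) (volume.restrict Ω) := by
    have e : (fun x => |f x - trunc k (f x)|) =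
        fun x => max ((|f x| ^ q) ^ (1 / q) - k) 0 := by
      funext x
      rw [(sle_trunc_abs hk).1, ← Real.rpow_mul (abs_nonneg _), mul_one_div_cancel hq.ne',
        Real.rpow_one]
    rw [e]
    have h1 := hf.aestronglyMeasurable.aemeasurable
    exact (((h1.pow_const _).sub_const k).max aemeasurable_const).aestronglyMeasurable
  refine MemLp.of_bound hm M ?_
  filter_upwards [ae_restrict_mem hΩo.measurableSet] with x hx
  rw [Real.norm_eq_abs, abs_abs, (sle_trunc_abs hk).1]
  exact max_le (by linarith [hM x hx]) ((abs_nonneg _).trans (hM x hx))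

lemma sle_params {d γ q p : ℝ} (hd : 2 < d) (hγ1 : (d + 2) / d < γ) (hγ2 : γ < 2)
    (hq : q = d * (γ - 1) / γ) (hp : p = d * (γ - 1) / (2 - γ)) :
    1 < γ ∧ 1 < q ∧ 0 < p ∧ 2 < p * (d - 2) / d ∧ (p * (d - 2) / d) * d / (d - 2) = p ∧
      q.HolderConjugate (p / (p * (d - 2) / d - 1)) := by
  have hd0 : 0 < d := by linarith
  have h1 : d + 2 < γ * d := by rwa [div_lt_iff₀ hd0] at hγ1
  have hγ : 1 < γ := by nlinarith
  have h2 : 0 < 2 - γ := by linarith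
  have hg1 : 0 < γ - 1 := by linarith
  have hq1 : 1 < q := by
    rw [hq, lt_div_iff₀ (by linarith)]; nlinarith
  have hp0 : 0 < p := by rw [hp]; positivity
  have hs : p * (d - 2) / d = (d - 2) * (γ - 1) / (2 - γ) := by
    rw [hp]; field_simp
  have hs2 : 2 < p * (d - 2) / d := by
    rw [hs, lt_div_iff₀ h2]; nlinarith
  refine ⟨hγ, hq1, hp0, hs2, ?_, ?_⟩
  · have : d - 2 ≠ 0 := by linarith
    field_simp
  · rw [Real.holderConjugate_iff]
    refine ⟨hq1, ?_⟩
    rw [inv_div, hs, hq, hp, inv_div]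
    field_simp
    ring

/-- Proposition `stabLpest`: stability `L^p` estimate at the
critical exponent `q = d(γ-1)/γ`. -/
theorem stability_Lp_estimate
    (d : ℕ) (γ q p lam CH : ℝ) (Ω : Set (Euc d)) (f : Euc d → ℝ)
    (hd : 2 < d)
    (hγ1 : ((d : ℝ) + 2) / (d : ℝ) < γ) (hγ2 : γ < 2)
    (hq : q = (d : ℝ) * (γ - 1) / γ) (hp : p = (d : ℝ) * (γ - 1) / (2 - γ))
    (hlam : 0 < lam) (hCH : 0 < CH)
    (hΩo : IsOpen Ω) (hΩb : Bornology.IsBounded Ω)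
    (hf : IntegrableOn (fun x => |f x| ^ q) Ω) :
    ∃ C : ℝ, ∀ (H : Euc d → Euc d → ℝ) (k : ℝ) (u uk : Euc d → ℝ),
      GrowthH Ω CH γ H →
      (∀ x ∈ Ω, ConvexOn ℝ Set.univ (H x) ∧ Differentiable ℝ (H x)) →
      0 < k →
      IsClassicalSol Ω lam H f u →
      IsClassicalSol Ω lam H (fun x => trunc k (f x)) uk →
      Lnorm p Ω (fun x => u x - uk x)
        ≤ C * Lnorm q Ω (fun x => f x - trunc k (f x)) := by
  have hd' : (2:ℝ) < d := by exact_mod_cast hd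
  obtain ⟨hγ, hq1, hp0, hs, hps, hconj⟩ := sle_params hd' hγ1 hγ2 hq hp
  have hq0 : 0 < q := by linarith
  by_cases hbd : ∃ M, 0 ≤ M ∧ ∀ x ∈ Ω, |f x| ≤ M
  swap
  · refine ⟨0, fun H k u uk hH _ _ hu _ => ?_⟩
    exact absurd (sle_rhs_bounded hΩb hCH (by linarith) hH hu) hbd
  obtain ⟨M, hM, hfM⟩ := hbd
  obtain ⟨κ, ε, C4, hκ, hε, hC4, hstep⟩ :=
    sle_step hd hγ hγ2 hlam hCH hM hs hps hconj
  have hεp : 0 < ε ^ (1 / p) := Real.rpow_pos_of_pos hε _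
  set K0 : ℝ := 2 * C4 / (κ * ε ^ (1 / p)) with hK0
  have hK0pos : 0 < K0 := by positivity
  set D : ℝ := 3 ^ p * (K0 ^ p * volume.real Ω + 2 * C4 ^ p) with hD
  have hDpos : 0 < D := by positivity
  refine ⟨D ^ (1 / p), ?_⟩
  intro H k u uk hH hconv hk hu huk
  obtain ⟨v1, hv1, hs1, he1⟩ := sle_ext_sol hΩb hu
  obtain ⟨v2, hv2, hs2, he2⟩ := sle_ext_sol hΩb huk
  set g : Euc d → ℝ := Ω.indicator (fun x => |f x - trunc k (f x)|) with hg
  have hgm : MemLp g (ENNReal.ofReal q) volume := sle_g_memLp hΩo hΩb hq0 hk hf hfM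
  have hg0 : ∀ x, 0 ≤ g x := fun x => Set.indicator_nonneg (fun _ _ => abs_nonneg _) x
  have hgx : ∀ x ∈ Ω, g x = |f x - trunc k (f x)| := fun x hx => Set.indicator_of_mem hx _
  have hgI : ∫ x, g x ^ q = ∫ x in Ω, |f x - trunc k (f x)| ^ q := by
    rw [← integral_indicator hΩo.measurableSet]
    congr 1
    funext x
    by_cases hx : x ∈ Ω
    · rw [hgx x hx, Set.indicator_of_mem hx]
    · rw [hg, Set.indicator_of_notMem hx, Set.indicator_of_notMem hx, Real.zero_rpow hq0.ne']
  set N : ℝ := Lnorm q Ω (fun x => f x - trunc k (f x)) with hN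
  have hI0 : 0 ≤ ∫ x in Ω, |f x - trunc k (f x)| ^ q :=
    integral_nonneg fun x => Real.rpow_nonneg (abs_nonneg _) _
  have hN0 : 0 ≤ N := Real.rpow_nonneg hI0 _
  have hNq : ∫ x, g x ^ q = N ^ q := by
    rw [hgI, hN, Lnorm, ← Real.rpow_mul hI0, one_div_mul_cancel hq0.ne', Real.rpow_one]
  have hL : Lnorm p Ω (fun x => u x - uk x) = (∫ x in Ω, |v1 x - v2 x| ^ p) ^ (1 / p) := by
    unfold Lnorm
    congr 1
    refine setIntegral_congr_fun hΩo.measurableSet fun x hx => ?_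
    simp only [he1 x hx, he2 x hx]
  have key : ∀ G, N < G → Lnorm p Ω (fun x => u x - uk x) ≤ D ^ (1 / p) * G := by
    intro G hG
    have hGpos : 0 < G := hN0.trans_lt hG
    have hgG : ∫ x, g x ^ q ≤ G ^ q := by
      rw [hNq]; exact Real.rpow_le_rpow hN0 hG.le hq0.le
    have hcv : ∀ x ∈ Ω, ConvexOn ℝ Set.univ (H x) := fun x hx => (hconv x hx).1
    have htM : ∀ x ∈ Ω, |trunc k (f x)| ≤ M := fun x hx =>
      (sle_trunc_abs hk).2.trans (hfM x hx)
    have c1 := hv1.continuous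
    have c2 := hv2.continuous
    have z1 : ∀ x ∈ frontier Ω, v1 x - v2 x = 0 := fun x hx => by
      rw [hs1.2.1 x hx, hs2.2.1 x hx, sub_zero]
    have z2 : ∀ x ∈ frontier Ω, v2 x - v1 x = 0 := fun x hx => by
      rw [hs1.2.1 x hx, hs2.2.1 x hx, sub_zero]
    have hA : 0 < C4 * G := mul_pos hC4 hGpos
    have L1 := sle_level hΩo hΩb (c1.sub c2) z1 hκ hε hA hp0
      (fun l hl hv => hstep Ω H f (fun x => trunc k (f x)) v1 v2 g l G hΩo hΩb hH hcv htM
        hv1 hv2 hs1 hs2 (fun x hx => (hgx x hx).ge) hl hg0 hgm hGpos.le hgG hv)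
    have L2 := sle_level hΩo hΩb (c2.sub c1) z2 hκ hε hA hp0
      (fun l hl hv => hstep Ω H (fun x => trunc k (f x)) f v2 v1 g l G hΩo hΩb hH hcv hfM
        hv2 hv1 hs2 hs1 (fun x hx => by rw [abs_sub_comm]; exact (hgx x hx).ge)
        hl hg0 hgm hGpos.le hgG hv)
    have hl : 2 * (C4 * G) / (κ * ε ^ (1 / p)) = K0 * G := by rw [hK0]; ring
    rw [hl] at L1 L2
    have hfin := sle_combine hΩo hΩb (c1.sub c2) z1 (fun x => (neg_sub _ _).symm)
      (mul_pos hK0pos hGpos) hp0 L1 L2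
    have hfin2 : ∫ x in Ω, |v1 x - v2 x| ^ p ≤ D * G ^ p := by
      refine hfin.trans_eq ?_
      rw [hD, Real.mul_rpow hK0pos.le hGpos.le, Real.mul_rpow hC4.le hGpos.le]
      ring
    rw [hL]
    calc (∫ x in Ω, |v1 x - v2 x| ^ p) ^ (1 / p) ≤ (D * G ^ p) ^ (1 / p) :=
          Real.rpow_le_rpow (integral_nonneg fun x => Real.rpow_nonneg (abs_nonneg _) _)
            hfin2 (by positivity)
      _ = D ^ (1 / p) * G := by
          rw [Real.mul_rpow hDpos.le (by positivity), ← Real.rpow_mul hGpos.le,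
            mul_one_div_cancel hp0.ne', Real.rpow_one]
  have hDp : 0 < D ^ (1 / p) := Real.rpow_pos_of_pos hDpos _
  rw [mul_comm, ← div_le_iff₀ hDp]
  refine le_of_forall_gt_imp_ge_of_dense fun G hG => ?_
  rw [div_le_iff₀ hDp, mul_comm]
  exact key G hG

end
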